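/- arXiv:2012.11063 — 2 statements merged into one kernel-verified Lean document; each statement's English description precedes it below -/
import Mathlib

section
/- Let x, y be complex numbers with Re x < 0, 0 < Re y < 1, |x| < 1/2, |y| < 1/4, and set z² = xy/2. Let u(t) = 1 − (xy/2) Φ₀(x,y,z;t). Then for every real t with 0 < t < 1, u(t) = −x t^{x} ∫₀^{t} s^{−1−x} (1−s)^{−y} F(−y/2, (1−x−y)/2, (1−x)/2; s²) ds = −x Σ_{m≥0} t^{2m} ( (−y/2)ₘ ((1−x−y)/2)ₘ / (m! ((1−x)/2)ₘ) ) ∫₀^{1} s^{2m−1−x} (1−ts)^{−y} ds, where powers are principal values. -/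
open Complex Filter Metric Finset

attribute [local instance] Classical.propDecidable

noncomputable section

/-- Condition on the summation variables of the level-two multiple polylogarithm:
`m` is strictly increasing, `m i ≡ i+1 (mod 2)` (so `m 0` is odd, `m 1` even, ...),
and all `m i` are positive. -/
def athCond (n : ℕ) (m : Fin n → ℕ) : Prop :=
  StrictMono m ∧ ∀ i : Fin n, m i % 2 = ((i : ℕ) + 1) % 2 ∧ 0 < m i

/-- The last entry `m n` of the summation sequence (junk value `0` for depth `0`). -/
def lastExp {n : ℕ} (m : Fin n → ℕ) : ℕ :=
  if h : 0 < n then m ⟨n - 1, Nat.sub_lt h Nat.one_pos⟩ else 0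

/-- The level-two multiple polylogarithm
`Ath(𝐤; t) = Σ_{0<m₁<⋯<mₙ, mᵢ ≡ i (2)} t^{mₙ}/(m₁^{k₁}⋯mₙ^{kₙ})`, with `Ath(∅;t) = 1`. -/
def Ath {n : ℕ} (k : Fin n → ℕ) (t : ℂ) : ℂ :=
  ∑' m : Fin n → ℕ,
    if athCond n m then t ^ lastExp m / ∏ i, ((m i : ℂ) ^ k i) else 0

/-- The multiple T-value `T(𝐤) = 2^n Σ_{0<m₁<⋯<mₙ, mᵢ ≡ i (2)} 1/(m₁^{k₁}⋯mₙ^{kₙ})`. -/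
def Tval {n : ℕ} (k : Fin n → ℕ) : ℝ :=
  2 ^ n * ∑' m : Fin n → ℕ,
    if athCond n m then (∏ i, ((m i : ℝ) ^ k i))⁻¹ else 0

/-- `κ` is an index of weight `k`, depth `n` and height `s`. -/
def IdxCond (k n s : ℕ) (κ : Fin n → ℕ) : Prop :=
  (∀ i, 1 ≤ κ i) ∧ (∑ i, κ i) = k ∧ (Finset.univ.filter fun i => 2 ≤ κ i).card = s

/-- `κ` is an admissible index of weight `k`, depth `n` and height `s`. -/
def IdxCond0 (k n s : ℕ) (κ : Fin n → ℕ) : Prop :=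
  IdxCond k n s κ ∧ ∀ h : 0 < n, 2 ≤ κ ⟨n - 1, Nat.sub_lt h Nat.one_pos⟩

/-- `G(k,n,s;t) = 2^n Σ_{𝐤 ∈ I(k,n,s)} Ath(𝐤;t)`. -/
def G (k n s : ℕ) (t : ℂ) : ℂ :=
  2 ^ n * ∑' κ : Fin n → ℕ, if IdxCond k n s κ then Ath κ t else 0

/-- `G₀(k,n,s;t) = 2^n Σ_{𝐤 ∈ I₀(k,n,s)} Ath(𝐤;t)`. -/
def G0 (k n s : ℕ) (t : ℂ) : ℂ :=
  2 ^ n * ∑' κ : Fin n → ℕ, if IdxCond0 k n s κ then Ath κ t else 0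

/-- `Σ_{𝐤 ∈ I₀(k,n,s)} T(𝐤)`. -/
def sumT0 (k n s : ℕ) : ℝ :=
  ∑' κ : Fin n → ℕ, if IdxCond0 k n s κ then Tval κ else 0

/-- One term of the generating function `Φ`. -/
def PhiTerm (x y z : ℂ) (p : ℕ × ℕ × ℕ) (t : ℂ) : ℂ :=
  if 1 ≤ p.1 ∧ 1 ≤ p.2.1 then
    G p.1 p.2.1 p.2.2 t * x ^ (p.1 - p.2.1 - p.2.2) * y ^ (p.2.1 - p.2.2) * z ^ (2 * p.2.2)
  else 0

/-- `Φ(x,y,z;t) = 1 + Σ_{k,n≥1, s≥0} G(k,n,s;t) x^{k−n−s} y^{n−s} z^{2s}`. -/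
def Phi (x y z t : ℂ) : ℂ := 1 + ∑' p : ℕ × ℕ × ℕ, PhiTerm x y z p t

/-- One term of the generating function `Φ₀`. -/
def Phi0Term (x y z : ℂ) (p : ℕ × ℕ × ℕ) (t : ℂ) : ℂ :=
  if 1 ≤ p.1 ∧ 1 ≤ p.2.1 ∧ 1 ≤ p.2.2 then
    G0 p.1 p.2.1 p.2.2 t * x ^ (p.1 - p.2.1 - p.2.2) * y ^ (p.2.1 - p.2.2)
      * z ^ (2 * (p.2.2 - 1))
  else 0

/-- `Φ₀(x,y,z;t) = Σ_{k,n,s≥1} G₀(k,n,s;t) x^{k−n−s} y^{n−s} z^{2(s−1)}`. -/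
def Phi0 (x y z t : ℂ) : ℂ := ∑' p : ℕ × ℕ × ℕ, Phi0Term x y z p t

/-- The shifted factorial `(a)ₙ = a(a+1)⋯(a+n−1)`. -/
def poch (a : ℂ) (n : ℕ) : ℂ := ∏ j ∈ Finset.range n, (a + j)

/-- The Gauss hypergeometric series `F(a,b,c;t)`. -/
def hypF (a b c t : ℂ) : ℂ :=
  ∑' n : ℕ, poch a n * poch b n / ((n.factorial : ℂ) * poch c n) * t ^ n


def uPc (y : ℂ) (j : ℕ) : ℂ := poch y j / (j.factorial : ℂ)

def uCc (x y : ℂ) (m : ℕ) : ℂ :=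
  poch (-y / 2) m * poch ((1 - x - y) / 2) m / ((m.factorial : ℂ) * poch ((1 - x) / 2) m)

def uFc (x y : ℂ) (M : ℕ) : ℂ := if M % 2 = 0 then uCc x y (M / 2) else 0

def uHc (x y : ℂ) (M : ℕ) : ℂ := ∑ kl ∈ Finset.HasAntidiagonal.antidiagonal M, uPc y kl.1 * uFc x y kl.2

theorem poch_succ (a : ℂ) (n : ℕ) : poch a (n + 1) = poch a n * (a + n) := by
  simp [poch, Finset.prod_range_succ]

theorem uPc_succ (y : ℂ) (j : ℕ) : (j + 1 : ℂ) * uPc y (j + 1) = (y + j) * uPc y j := by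
  have h1 : (j.factorial : ℂ) ≠ 0 := by exact_mod_cast j.factorial_ne_zero
  have h2 : (j + 1 : ℂ) ≠ 0 := by exact_mod_cast j.succ_ne_zero
  simp only [uPc, poch_succ, Nat.factorial_succ]
  push_cast
  field_simp

theorem poch_c_ne (x : ℂ) (hx : x.re < 0) (m : ℕ) : (1 - x) / 2 + (m : ℂ) ≠ 0 := by
  intro h
  have := congrArg Complex.re h
  simp at this
  have hm : (0 : ℝ) ≤ m := m.cast_nonneg
  linarith

theorem poch_c_ne' (x : ℂ) (hx : x.re < 0) (m : ℕ) : poch ((1 - x) / 2) m ≠ 0 := by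
  unfold poch
  exact Finset.prod_ne_zero_iff.mpr fun j _ => poch_c_ne x hx j

theorem uCc_succ (x y : ℂ) (hx : x.re < 0) (m : ℕ) :
    (m + 1 : ℂ) * ((1 - x) / 2 + m) * uCc x y (m + 1)
      = (-y / 2 + m) * ((1 - x - y) / 2 + m) * uCc x y m := by
  have h1 : (m.factorial : ℂ) ≠ 0 := by exact_mod_cast m.factorial_ne_zero
  have h2 : (m + 1 : ℂ) ≠ 0 := by exact_mod_cast m.succ_ne_zero
  have h3 := poch_c_ne x hx m
  have h4 := poch_c_ne' x hx m
  simp only [uCc, poch_succ, Nat.factorial_succ]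
  push_cast
  generalize hA : poch ((1 - x) / 2) m = A at *
  generalize hB : (1 - x) / 2 + (m : ℂ) = B at *
  field_simp

theorem uFc_succ (x y : ℂ) (hx : x.re < 0) (M : ℕ) :
    (M + 2 : ℂ) * (M + 1 - x) * uFc x y (M + 2)
      = (M - y) * (M + 1 - x - y) * uFc x y M := by
  unfold uFc
  have : (M + 2) % 2 = M % 2 := by omega
  rw [this]
  split_ifs with h
  · obtain ⟨m, rfl⟩ : ∃ m, M = 2 * m := ⟨M / 2, by omega⟩
    have e1 : (2 * m + 2) / 2 = m + 1 := by omega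
    have e2 : (2 * m) / 2 = m := by omega
    rw [e1, e2]
    have := uCc_succ x y hx m
    push_cast
    linear_combination 4 * this
  · simp

open PowerSeries in
def uTh (f : PowerSeries ℂ) : PowerSeries ℂ := X * derivative ℂ f

open PowerSeries in
theorem coeff_uTh (f : PowerSeries ℂ) (n : ℕ) : coeff n (uTh f) = n * coeff n f := by
  cases n with
  | zero => simp [uTh]
  | succ n =>
    rw [uTh, coeff_succ_X_mul, coeff_derivative]
    push_cast
    ring

theorem uTh_mul (f g : PowerSeries ℂ) : uTh (f * g) = uTh f * g + f * uTh g := by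
  simp [uTh]
  ring

theorem uTh_add (f g : PowerSeries ℂ) : uTh (f + g) = uTh f + uTh g := by
  simp [uTh]
  ring

open PowerSeries in
theorem uTh_C (c : ℂ) : uTh (C c) = 0 := by
  simp [uTh]

theorem uTh_one : uTh 1 = 0 := by
  simp [uTh]

open PowerSeries in
theorem uTh_X : uTh X = X := by
  simp [uTh]

open PowerSeries in
theorem uHc_ps (x y : ℂ) (hx : x.re < 0) (H : PowerSeries ℂ)
    (hH : H = PowerSeries.mk (uPc y) * PowerSeries.mk (uFc x y)) :
    uTh (uTh H) - C (1 + x) * uTh H = X ^ 2 * (uTh (uTh H) + C (1 - x) * uTh H)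
      + C y * X * (2 * uTh H - C x * H) := by
  set P := PowerSeries.mk (uPc y) with hP
  set F := PowerSeries.mk (uFc x y) with hF
  have e1 : uTh P = X * uTh P + C y * (X * P) := by
    ext n
    cases n with
    | zero => simp [coeff_uTh]
    | succ n =>
      rw [map_add, coeff_C_mul, coeff_succ_X_mul, coeff_succ_X_mul, coeff_uTh, coeff_uTh, hP,
        coeff_mk, coeff_mk]
      push_cast
      linear_combination uPc_succ y n
  have e2 : uTh (uTh P) = X * uTh P + X * uTh (uTh P) + C y * (X * P + X * uTh P) := by
    have := congrArg uTh e1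
    rw [uTh_add, uTh_mul, uTh_mul, uTh_mul, uTh_C, uTh_X] at this
    linear_combination this
  have e3 : uTh (uTh F) - C (1 + x) * uTh F
      = X ^ 2 * (uTh (uTh F) + C (1 - x - 2 * y) * uTh F - C (y * (1 - x - y)) * F) := by
    ext n
    match n with
    | 0 =>
      rw [coeff_X_pow_mul', map_sub, coeff_C_mul, coeff_uTh, coeff_uTh]
      simp
    | 1 =>
      rw [coeff_X_pow_mul', map_sub, coeff_C_mul, coeff_uTh, coeff_uTh, hF, coeff_mk]
      simp [uFc]
    | n + 2 =>
      rw [coeff_X_pow_mul]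
      rw [LinearMap.map_sub, LinearMap.map_sub, LinearMap.map_add, coeff_C_mul, coeff_C_mul, coeff_C_mul, coeff_uTh, coeff_uTh,
        coeff_uTh, coeff_uTh, hF, coeff_mk, coeff_mk]
      push_cast
      linear_combination uFc_succ x y hx n
  have h1 : uTh H = uTh P * F + P * uTh F := by rw [hH, uTh_mul]
  have h2 : uTh (uTh H) = uTh (uTh P) * F + 2 * uTh P * uTh F + P * uTh (uTh F) := by
    rw [h1, uTh_add, uTh_mul, uTh_mul]; ring
  have hne : (1 - X : PowerSeries ℂ) ≠ 0 := by
    intro h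
    have := congrArg (coeff 0) h
    simp at this
  rw [h2, h1, hH]
  simp only [map_sub, map_add, map_mul, map_one, map_ofNat] at *
  have key := mul_left_cancel₀ (pow_ne_zero 2 hne) (a := (1 - X : PowerSeries ℂ) ^ 2)
    (b := uTh (uTh P) * F + 2 * uTh P * uTh F + P * uTh (uTh F)
       - (1 + C x) * (uTh P * F + P * uTh F))
    (c := X ^ 2 * (uTh (uTh P) * F + 2 * uTh P * uTh F + P * uTh (uTh F)
        + (1 - C x) * (uTh P * F + P * uTh F))
      + C y * X * (2 * (uTh P * F + P * uTh F) - C x * (P * F)))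
  apply key
  generalize uTh (uTh P) = P2 at *
  generalize uTh P = P1 at *
  generalize uTh (uTh F) = F2 at *
  generalize uTh F = F1 at *
  generalize C x = cx at *
  generalize C y = cy at *
  generalize (X : PowerSeries ℂ) = X at *
  clear key h1 h2 hne hH hP hF
  linear_combination (1-X)*(1-X^2)*F*e2 + ((1-X^2)*F*X*(1+cy)
    + (1-X)*(2*F1*(1-X^2) - ((1+cx) + X^2*(1-cx) + 2*cy*X)*F))*e1 + (1-X)^2*P*e3

open PowerSeries in
theorem uHc_rec (x y : ℂ) (hx : x.re < 0) (M : ℕ) :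
    (M + 1 - x) * (M + 2) * uHc x y (M + 2) = (M + 1 - x) * M * uHc x y M
      + y * (2 * (M + 1) - x) * uHc x y (M + 1) := by
  have hc : ∀ n, coeff n (PowerSeries.mk (uPc y) * PowerSeries.mk (uFc x y)) = uHc x y n := by
    intro n
    simp [coeff_mul, uHc]
  have := congrArg (coeff (M + 2)) (uHc_ps x y hx _ rfl)
  rw [LinearMap.map_sub, LinearMap.map_add, coeff_C_mul, coeff_X_pow_mul, mul_assoc (C y),
    coeff_C_mul, coeff_succ_X_mul, LinearMap.map_add, coeff_C_mul, LinearMap.map_sub, coeff_C_mul,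
    two_mul, LinearMap.map_add] at this
  simp only [coeff_uTh, hc] at this
  push_cast at this
  linear_combination this

theorem uHc_zero (x y : ℂ) : uHc x y 0 = 1 := by
  simp [uHc, uPc, uFc, uCc, poch]

theorem uHc_one (x y : ℂ) : uHc x y 1 = y := by
  simp [uHc, uPc, uFc, uCc, poch, Finset.Nat.antidiagonal_succ]



theorem hs_conv {ι : Type*} {𝕜 : Type*} [AddCommMonoid 𝕜] [TopologicalSpace 𝕜] {f g : ι → 𝕜}
    {a b : 𝕜} (h : HasSum f a) (hf : ∀ i, g i = f i) (hb : b = a) : HasSum g b := by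
  rw [hb, funext hf]; exact h

theorem norm_uPc_le (y : ℂ) (hy : ‖y‖ < 1 / 4) (j : ℕ) : ‖uPc y j‖ ≤ 1 := by
  induction j with
  | zero => simp [uPc, poch]
  | succ j ih =>
    have h := congrArg norm (uPc_succ y j)
    rw [norm_mul, norm_mul] at h
    have h1 : ‖(j + 1 : ℂ)‖ = j + 1 := by
      have : (j + 1 : ℂ) = ((j + 1 : ℕ) : ℂ) := by push_cast; ring
      rw [this, Complex.norm_natCast]; push_cast; ring
    have h2 : ‖y + j‖ ≤ j + 1 := by
      refine (norm_add_le _ _).trans ?_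
      rw [Complex.norm_natCast]; linarith
    rw [h1] at h
    have hj : (0 : ℝ) < j + 1 := by positivity
    by_contra hc
    push Not at hc
    nlinarith [norm_nonneg (y + j), norm_nonneg (uPc y j)]

theorem norm_uCc_le (x y : ℂ) (hx : x.re < 0) (hy : ‖y‖ < 1 / 4) (m : ℕ) : ‖uCc x y m‖ ≤ 1 := by
  induction m with
  | zero => simp [uCc, poch]
  | succ m ih =>
    have h := congrArg norm (uCc_succ x y hx m)
    simp only [norm_mul] at h
    have h1 : ‖(m + 1 : ℂ)‖ = m + 1 := by
      have : (m + 1 : ℂ) = ((m + 1 : ℕ) : ℂ) := by push_cast; ring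
      rw [this, Complex.norm_natCast]; push_cast; ring
    have hm : (0 : ℝ) ≤ m := m.cast_nonneg
    have hy2 : ‖y / 2‖ ≤ 1 / 8 := by
      rw [norm_div]; simp; linarith
    have h2 : ‖-y / 2 + m‖ ≤ m + 1 / 8 := by
      refine (norm_add_le _ _).trans ?_
      rw [Complex.norm_natCast, neg_div, norm_neg]; linarith
    have h3 : m + 1 / 2 ≤ ‖(1 - x) / 2 + m‖ := by
      refine le_trans ?_ (Complex.re_le_norm _)
      simp
      linarith
    have h4 : ‖(1 - x - y) / 2 + m‖ ≤ ‖(1 - x) / 2 + m‖ + 1 / 8 := by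
      have : (1 - x - y) / 2 + (m : ℂ) = ((1 - x) / 2 + m) - y / 2 := by ring
      rw [this]
      refine (norm_sub_le _ _).trans ?_
      linarith
    rw [h1] at h
    generalize ‖(1 - x) / 2 + (m : ℂ)‖ = B at *
    generalize ‖(1 - x - y) / 2 + (m : ℂ)‖ = B' at *
    have hA := norm_nonneg (-y / 2 + (m : ℂ))
    generalize ‖-y / 2 + (m : ℂ)‖ = A at *
    by_contra hc
    push Not at hc
    have hB : 0 < (m + 1) * B := by nlinarith
    have k1 : (m + 1) * B < A * B' * ‖uCc x y m‖ := by
      rw [← h]; nlinarith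
    have k2 : A * B' ≤ (m + 1 / 8) * (B + 1 / 8) := by
      refine (mul_le_mul_of_nonneg_left h4 hA).trans ?_
      exact mul_le_mul_of_nonneg_right h2 (by linarith)
    have k3 : A * B' * ‖uCc x y m‖ ≤ (m + 1 / 8) * (B + 1 / 8) * 1 :=
      mul_le_mul k2 ih (norm_nonneg _) (by nlinarith)
    nlinarith

theorem norm_uFc_le (x y : ℂ) (hx : x.re < 0) (hy : ‖y‖ < 1 / 4) (m : ℕ) : ‖uFc x y m‖ ≤ 1 := by
  unfold uFc
  split_ifs
  · exact norm_uCc_le x y hx hy _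
  · simp

theorem poch_eq_asc (a : ℂ) (n : ℕ) : (ascPochhammer ℕ n).smeval a = poch a n := by
  induction n with
  | zero => simp [poch, Polynomial.smeval_one]
  | succ n ih =>
    rw [ascPochhammer_succ_right, Polynomial.smeval_mul, ih, poch_succ, Polynomial.smeval_add,
      Polynomial.smeval_X, Polynomial.smeval_natCast]
    simp

theorem uPc_hasSum (y s : ℂ) (hs : ‖s‖ < 1) :
    HasSum (fun j => uPc y j * s ^ j) ((1 - s) ^ (-y)) := by
  have h := (Complex.one_div_one_sub_cpow_hasFPowerSeriesOnBall_zero y).hasSum (y := s)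
    (by
      rw [Metric.mem_eball, edist_zero_right, ← ofReal_norm,
        ENNReal.ofReal_lt_one]
      exact hs)
  rw [Complex.cpow_neg]
  refine hs_conv h (fun j => ?_) ?_
  · rw [FormalMultilinearSeries.ofScalars_apply_eq, Ring.choose]
    have e : y + (j : ℂ) - 1 - j + 1 = y := by ring
    rw [e]
    have := Ring.factorial_nsmul_multichoose_eq_ascPochhammer y j
    rw [poch_eq_asc] at this
    have h1 : (j.factorial : ℂ) ≠ 0 := by exact_mod_cast j.factorial_ne_zero
    rw [uPc, ← this]
    simp [h1]
  · simp

theorem summable_bd (K : ℕ → ℂ) (hK : ∀ j, ‖K j‖ ≤ 1) (s : ℂ) (hs : ‖s‖ < 1) :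
    Summable (fun j => ‖K j * s ^ j‖) := by
  refine Summable.of_nonneg_of_le (fun _ => norm_nonneg _) (fun j => ?_)
    (summable_geometric_of_lt_one (norm_nonneg s) hs)
  rw [norm_mul, norm_pow]
  have := pow_nonneg (norm_nonneg s) j
  nlinarith [hK j]

theorem uFc_hasSum (x y s : ℂ) (hx : x.re < 0) (hy : ‖y‖ < 1 / 4) (hs : ‖s‖ < 1) :
    HasSum (fun j => uFc x y j * s ^ j)
      (hypF (-y / 2) ((1 - x - y) / 2) ((1 - x) / 2) (s ^ 2)) := by
  have hinj : Function.Injective (fun m : ℕ => 2 * m) := fun a b h => by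
    simp at h; exact h
  rw [← hinj.hasSum_iff]
  · have hs2 : ‖s ^ 2‖ < 1 := by
      rw [norm_pow]; nlinarith [norm_nonneg s]
    have := (summable_bd (uCc x y) (norm_uCc_le x y hx hy) (s ^ 2) hs2).of_norm.hasSum
    exact hs_conv this (fun m => by simp [uFc, pow_mul]) rfl
  · intro n hn
    have : n % 2 ≠ 0 := fun h => hn ⟨n / 2, by simp; omega⟩
    simp [uFc, this]

theorem uHc_summ (x y s : ℂ) (hx : x.re < 0) (hy : ‖y‖ < 1 / 4) (hs : ‖s‖ < 1) :
    Summable (fun j => ‖uHc x y j * s ^ j‖) ∧ HasSum (fun j => uHc x y j * s ^ j)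
      ((1 - s) ^ (-y) * hypF (-y / 2) ((1 - x - y) / 2) ((1 - x) / 2) (s ^ 2)) := by
  have h1 := summable_bd (uPc y) (norm_uPc_le y hy) s hs
  have h2 := summable_bd (uFc x y) (norm_uFc_le x y hx hy) s hs
  have e : ∀ n, ∑ kl ∈ Finset.HasAntidiagonal.antidiagonal n,
      uPc y kl.1 * s ^ kl.1 * (uFc x y kl.2 * s ^ kl.2) = uHc x y n * s ^ n := by
    intro n
    rw [uHc, Finset.sum_mul]
    refine Finset.sum_congr rfl fun kl hkl => ?_
    rw [← Finset.HasAntidiagonal.mem_antidiagonal.mp hkl, pow_add]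
    ring
  have h3 := summable_norm_sum_mul_antidiagonal_of_summable_norm h1 h2
  have h4 := tsum_mul_tsum_eq_tsum_sum_antidiagonal_of_summable_norm h1 h2
  simp only [e] at h3 h4
  refine ⟨h3, ?_⟩
  rw [(uPc_hasSum y s hs).tsum_eq, (uFc_hasSum x y s hx hy hs).tsum_eq] at h4
  rw [h4]
  exact h3.of_norm.hasSum

theorem int_hasSum (K : ℕ → ℂ) (f : ℝ → ℂ) (r : ℝ) (hr : 0 < r) (a : ℂ) (ha : -1 < a.re)
    (hK : Summable fun j => ‖K j * (r : ℂ) ^ j‖)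
    (hf : ∀ s : ℝ, 0 < s → s ≤ r → HasSum (fun j => K j * (s : ℂ) ^ j) (f s)) :
    HasSum (fun j : ℕ => K j * ((r : ℂ) ^ (j + a + 1) / (j + a + 1)))
      (∫ s in (0 : ℝ)..r, (s : ℂ) ^ a * f s) := by
  have hint : ∀ j : ℕ, ∫ s in (0 : ℝ)..r, (s : ℂ) ^ a * (K j * (s : ℂ) ^ j)
      = K j * ((r : ℂ) ^ (j + a + 1) / (j + a + 1)) := by
    intro j
    have hre : -1 < (j + a : ℂ).re := by
      simp
      have : (0 : ℝ) ≤ j := j.cast_nonneg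
      linarith
    have hne : (j + a + 1 : ℂ) ≠ 0 := by
      intro h
      have := congrArg Complex.re h
      simp at this hre
      linarith
    have : ∫ s in (0 : ℝ)..r, (s : ℂ) ^ a * (K j * (s : ℂ) ^ j)
        = ∫ s in (0 : ℝ)..r, K j * (s : ℂ) ^ (j + a) := by
      refine intervalIntegral.integral_congr_ae ?_
      refine Filter.Eventually.of_forall fun s hs => ?_
      rw [Set.uIoc_of_le hr.le] at hs
      have : (s : ℂ) ≠ 0 := by exact_mod_cast hs.1.ne'
      rw [Complex.cpow_add _ _ this, Complex.cpow_natCast]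
      ring
    rw [this, intervalIntegral.integral_const_mul, integral_cpow (Or.inl hre)]
    simp [Complex.zero_cpow hne]
  rw [← funext hint]
  refine intervalIntegral.hasSum_integral_of_dominated_convergence
    (fun j s => ‖K j * (r : ℂ) ^ j‖ * s ^ a.re) ?_ ?_ ?_ ?_ ?_
  · intro j
    refine Measurable.aestronglyMeasurable ?_
    fun_prop
  · intro j
    refine Filter.Eventually.of_forall fun s hs => ?_
    rw [Set.uIoc_of_le hr.le] at hs
    rw [norm_mul, Complex.norm_cpow_eq_rpow_re_of_pos hs.1, mul_comm]
    refine mul_le_mul_of_nonneg_right ?_ (Real.rpow_nonneg hs.1.le _)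
    rw [norm_mul, norm_mul, norm_pow, norm_pow, Complex.norm_real, Complex.norm_real,
      Real.norm_of_nonneg hs.1.le, Real.norm_of_nonneg hr.le]
    exact mul_le_mul_of_nonneg_left (pow_le_pow_left₀ hs.1.le hs.2 _) (norm_nonneg _)
  · exact Filter.Eventually.of_forall fun s hs => hK.mul_right _
  · simp only [tsum_mul_right]
    exact (intervalIntegral.intervalIntegrable_rpow' ha).const_mul _
  · refine Filter.Eventually.of_forall fun s hs => ?_
    rw [Set.uIoc_of_le hr.le] at hs
    exact (hf s hs.1 hs.2).mul_left _

theorem rhs_one (x y : ℂ) (hrex : x.re < 0) (hy : ‖y‖ < 1 / 4)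
    (t : ℝ) (ht0 : 0 < t) (ht1 : t < 1) :
    HasSum (fun M : ℕ => uHc x y M * (t : ℂ) ^ M / (M - x)) ((t : ℂ) ^ x
            * ∫ s in (0 : ℝ)..t, ((s : ℂ) ^ (-1 - x) * (1 - (s : ℂ)) ^ (-y)
                * hypF (-y / 2) ((1 - x - y) / 2) ((1 - x) / 2) ((s : ℂ) ^ 2))) := by
  have hn : ∀ s : ℝ, 0 < s → s ≤ t → ‖(s : ℂ)‖ < 1 := fun s h1 h2 => by
    rw [Complex.norm_real, Real.norm_of_nonneg h1.le]; linarith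
  have := (int_hasSum (uHc x y) (fun s => (1 - (s : ℂ)) ^ (-y)
    * hypF (-y / 2) ((1 - x - y) / 2) ((1 - x) / 2) ((s : ℂ) ^ 2)) t ht0 (-1 - x)
    (by simp; linarith) (uHc_summ x y t hrex hy (hn t ht0 le_rfl)).1
    (fun s h1 h2 => (uHc_summ x y s hrex hy (hn s h1 h2)).2)).mul_left ((t : ℂ) ^ x)
  simp only [mul_assoc] at this ⊢
  refine hs_conv this (fun M => ?_) rfl
  have ht : (t : ℂ) ≠ 0 := by exact_mod_cast ht0.ne'
  have e1 : (M : ℂ) + (-1 - x) + 1 = M - x := by ring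
  rw [e1, Complex.cpow_sub _ _ ht, Complex.cpow_natCast]
  have : (t : ℂ) ^ x ≠ 0 := by simp [Complex.cpow_eq_zero_iff, ht]
  field_simp

theorem rhs_two (x y : ℂ) (hrex : x.re < 0) (hy : ‖y‖ < 1 / 4)
    (t : ℝ) (ht0 : 0 < t) (ht1 : t < 1) :
    ∑' M : ℕ, uHc x y M * (t : ℂ) ^ M / (M - x) = ∑' m : ℕ, (t : ℂ) ^ (2 * m)
            * (poch (-y / 2) m * poch ((1 - x - y) / 2) m
                / ((m.factorial : ℂ) * poch ((1 - x) / 2) m))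
            * ∫ s in (0 : ℝ)..1,
                ((s : ℂ) ^ (2 * (m : ℂ) - 1 - x) * (1 - (t : ℂ) * (s : ℂ)) ^ (-y)) := by
  have hnt : ‖(t : ℂ)‖ < 1 := by
    rw [Complex.norm_real, Real.norm_of_nonneg ht0.le]; linarith
  have h1 := summable_bd (uPc y) (norm_uPc_le y hy) t hnt
  have h2 := summable_bd (uFc x y) (norm_uFc_le x y hrex hy) t hnt
  have hI : ∀ m : ℕ, HasSum (fun j : ℕ => uPc y j * (t : ℂ) ^ j / (j + (2 * m : ℕ) - x))
     (∫ s in (0 : ℝ)..1,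
                ((s : ℂ) ^ (2 * (m : ℂ) - 1 - x) * (1 - (t : ℂ) * (s : ℂ)) ^ (-y))) := by
    intro m
    have := int_hasSum (fun j => uPc y j * (t : ℂ) ^ j) (fun s => (1 - (t : ℂ) * (s : ℂ)) ^ (-y))
      1 one_pos (2 * (m : ℂ) - 1 - x) (by
        simp
        have : (0 : ℝ) ≤ m := m.cast_nonneg
        linarith) (by simpa using h1) (fun s hs1 hs2 => by
          have hs : ‖(t : ℂ) * s‖ < 1 := by
            rw [norm_mul, Complex.norm_real, Complex.norm_real, Real.norm_of_nonneg ht0.le,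
              Real.norm_of_nonneg hs1.le]
            nlinarith
          have := uPc_hasSum y (t * s) hs
          simpa only [mul_pow, mul_assoc] using this)
    refine hs_conv this (fun j => ?_) rfl
    have e : (j : ℂ) + (2 * m - 1 - x) + 1 = j + (2 * m : ℕ) - x := by push_cast; ring
    rw [e, Complex.ofReal_one, Complex.one_cpow]
    ring
  have hg := summable_mul_of_summable_norm h1 h2
  have hg' : Summable (fun p : ℕ × ℕ => uPc y p.1 * (t : ℂ) ^ p.1 * (uFc x y p.2 * (t : ℂ) ^ p.2)
      / (p.1 + p.2 - x)) := by
    refine Summable.of_norm_bounded (hg.norm.mul_right ((-x.re)⁻¹)) fun p => ?_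
    rw [norm_div, div_eq_mul_inv]
    refine mul_le_mul_of_nonneg_left ?_ (norm_nonneg _)
    refine inv_anti₀ (by linarith) ?_
    refine le_trans ?_ (Complex.re_le_norm _)
    simp
    positivity
  have hB := hg'.hasSum
  have hC := (Finset.HasAntidiagonal.sigmaAntidiagonalEquivProd (A := ℕ)).hasSum_iff.mpr hB
  have hD := hC.sigma (g := fun M : ℕ => uHc x y M * (t : ℂ) ^ M / (M - x)) (fun M => by
    have := hasSum_fintype (fun c : Finset.HasAntidiagonal.antidiagonal M =>
      uPc y c.1.1 * (t : ℂ) ^ c.1.1 * (uFc x y c.1.2 * (t : ℂ) ^ c.1.2) / (c.1.1 + c.1.2 - x))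
    refine hs_conv this (fun _ => rfl) ?_
    rw [Finset.sum_coe_sort (Finset.HasAntidiagonal.antidiagonal M) (fun c : ℕ × ℕ =>
      uPc y c.1 * (t : ℂ) ^ c.1 * (uFc x y c.2 * (t : ℂ) ^ c.2) / (c.1 + c.2 - x)), uHc,
      Finset.sum_mul, Finset.sum_div]
    refine Finset.sum_congr rfl fun kl hkl => ?_
    rw [← Finset.HasAntidiagonal.mem_antidiagonal.mp hkl, pow_add]
    push_cast
    ring)
  rw [hD.tsum_eq]
  have hE := ((Equiv.prodComm ℕ ℕ).hasSum_iff.mpr hB).prod_fiberwise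
    (g := fun N => ∑' j, uPc y j * (t : ℂ) ^ j * (uFc x y N * (t : ℂ) ^ N) / (j + N - x))
    (fun N => by
      have := (((Equiv.prodComm ℕ ℕ).summable_iff.mpr hg').prod_factor N).hasSum
      exact this)
  rw [← hE.tsum_eq]
  have hinj : Function.Injective (fun m : ℕ => 2 * m) := fun a b h => by
    simp at h; exact h
  rw [← hinj.tsum_eq]
  · refine tsum_congr fun m => ?_
    rw [← (hI m).tsum_eq, ← tsum_mul_left]
    refine tsum_congr fun j => ?_
    have : uFc x y (2 * m) = uCc x y m := by simp [uFc]
    rw [this, uCc]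
    ring
  · intro n hn
    by_contra hc
    have : n % 2 ≠ 0 := fun h => hc ⟨n / 2, by simp; omega⟩
    simp [uFc, this] at hn



section chain

variable {𝕜 : Type*} [RCLike 𝕜]

def eW (x y zz : 𝕜) (k m : ℕ) : 𝕜 :=
  if k = 0 then 0 else if k = 1 then 2 * y / m else 2 * zz * x ^ (k - 2) / m ^ k

def vW (x t : 𝕜) (k M : ℕ) : 𝕜 :=
  if k < 2 then 0 else 2 * x ^ (k - 2) / M ^ k * t ^ M

def wS (x y zz : 𝕜) (m : ℕ) : 𝕜 := 2 * y / m + 2 * zz / (m * (m - x))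

def vS (x t : 𝕜) (m : ℕ) : 𝕜 := 2 / (m * (m - x)) * t ^ m

def TT (w : ℕ → 𝕜) : ℕ → ℕ → 𝕜
  | 0, M => if M % 2 = 1 then 1 else 0
  | n + 1, M => if M % 2 = n % 2 then ∑ m ∈ Finset.range M, w m * TT w n m else 0

def FF (e : ℕ → ℕ → 𝕜) (n M : ℕ) (q : (Fin n → ℕ) × (Fin n → ℕ)) : 𝕜 :=
  if athCond (n + 1) (Fin.snoc (α := fun _ => ℕ) q.2 M) then ∏ i, e (q.1 i) (q.2 i) else 0

theorem athCond_snoc (n M : ℕ) (f : Fin (n + 1) → ℕ) :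
    athCond (n + 2) (Fin.snoc (α := fun _ => ℕ) f M) ↔
      athCond (n + 1) f ∧ f (Fin.last n) < M ∧ M % 2 = n % 2 := by
  unfold athCond
  rw [Fin.strictMono_iff_lt_succ, Fin.strictMono_iff_lt_succ, Fin.forall_fin_succ',
    Fin.forall_fin_succ' (n := n + 1)]
  have h1 : ∀ i : Fin n, (i.castSucc.succ : Fin (n + 2)) = (i.succ).castSucc := fun i => rfl
  have h2 : ((Fin.last n).succ : Fin (n + 2)) = Fin.last (n + 1) := rfl
  simp only [h1, h2, Fin.snoc_castSucc, Fin.snoc_last, Fin.val_castSucc, Fin.val_last]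
  constructor
  · rintro ⟨⟨a, b⟩, c, d, e⟩
    exact ⟨⟨a, c⟩, b, by omega⟩
  · rintro ⟨⟨a, c⟩, b, d⟩
    exact ⟨⟨a, b⟩, c, by omega, by omega⟩

theorem athCond_one (M : ℕ) (f : Fin 0 → ℕ) :
    athCond 1 (Fin.snoc (α := fun _ => ℕ) f M) ↔ M % 2 = 1 := by
  unfold athCond
  constructor
  · rintro ⟨_, h⟩
    have := (h (Fin.last 0)).1
    simpa [Fin.snoc] using this
  · intro h
    refine ⟨Subsingleton.strictMono _, fun i => ?_⟩
    have : i = Fin.last 0 := Subsingleton.elim _ _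
    subst this
    simp [Fin.snoc]
    omega

def chainEquiv (n : ℕ) : ℕ × (ℕ × ((Fin n → ℕ) × (Fin n → ℕ))) ≃
    (Fin (n + 1) → ℕ) × (Fin (n + 1) → ℕ) where
  toFun p := (Fin.snoc (α := fun _ => ℕ) p.2.2.1 p.2.1, Fin.snoc (α := fun _ => ℕ) p.2.2.2 p.1)
  invFun q := (q.2 (Fin.last n), q.1 (Fin.last n), fun i => q.1 i.castSucc, fun i => q.2 i.castSucc)
  left_inv p := by
    rcases p with ⟨a, b, c, d⟩
    simp
  right_inv q := by
    rcases q with ⟨a, b⟩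
    ext i
    · refine Fin.lastCases ?_ (fun i => ?_) i <;> simp
    · refine Fin.lastCases ?_ (fun i => ?_) i <;> simp

theorem hasSum_mul' {α β : Type*} {f : α → 𝕜} {g : β → 𝕜} {a b : 𝕜} (hf : HasSum f a)
    (hg : HasSum g b) : HasSum (fun p : α × β => f p.1 * g p.2) (a * b) := by
  have h1 : Summable (fun i => ‖f i‖) := hf.summable.norm
  have h2 : Summable (fun i => ‖g i‖) := hg.summable.norm
  exact hf.mul hg (summable_mul_of_summable_norm h1 h2)

theorem FF_hasSum (e : ℕ → ℕ → 𝕜) (w : ℕ → 𝕜) (hw : ∀ m, HasSum (fun k => e k m) (w m))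
    (n : ℕ) : ∀ M, HasSum (FF e n M) (TT w n M) := by
  induction n with
  | zero =>
    intro M
    refine hs_conv (hasSum_fintype _) (fun _ => rfl) ?_
    simp [FF, TT, athCond_one]
  | succ n ih =>
    intro M
    rw [← (chainEquiv n).hasSum_iff]
    by_cases hM : M % 2 = n % 2
    · have h1 : ∀ m : ℕ, HasSum (fun p : ℕ × (ℕ × ((Fin n → ℕ) × (Fin n → ℕ))) =>
          if p.1 = m then e p.2.1 m * FF e n m p.2.2 else 0) (w m * TT w n m) := by
        intro m
        have hinj : Function.Injective
            (fun b : ℕ × ((Fin n → ℕ) × (Fin n → ℕ)) => (m, b)) := fun a b h => by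
          simpa using h
        rw [← hinj.hasSum_iff]
        · refine hs_conv (hasSum_mul' (hw m) (ih m)) (fun p => ?_) rfl
          simp
        · intro p hp
          have : p.1 ≠ m := fun h => hp ⟨p.2, by rw [← h]⟩
          simp [this]
      have h2 := hasSum_sum (fun m (_ : m ∈ Finset.range M) => h1 m)
      refine hs_conv h2 (fun p => ?_) ?_
      · rcases p with ⟨m, k, κ, μ⟩
        rw [Finset.sum_ite_eq]
        simp only [Function.comp, chainEquiv, Equiv.coe_fn_mk, FF, athCond_snoc, Fin.snoc_last, hM,
          Finset.mem_range, and_true]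
        rw [Fin.prod_univ_castSucc]
        simp only [Fin.snoc_castSucc, Fin.snoc_last]
        by_cases hm : m < M
        · simp only [hm, and_true, if_true]
          split_ifs
          · ring
          · simp
        · simp [hm]
      · simp [TT, hM]
    · refine hs_conv hasSum_zero (fun p => ?_) ?_
      · simp [FF, chainEquiv, athCond_snoc, hM]
      · simp [TT, hM]

theorem TT_zero_of_le (w : ℕ → 𝕜) (n : ℕ) : ∀ M, M ≤ n → TT w n M = 0 := by
  induction n with
  | zero => intro M h; simp [TT]; omega
  | succ n ih =>
    intro M h
    simp only [TT]
    split_ifs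
    · refine Finset.sum_eq_zero fun m hm => ?_
      rw [ih m (by have := Finset.mem_range.mp hm; omega), mul_zero]
    · rfl

theorem TT_parity (w : ℕ → 𝕜) (n M : ℕ) (h : M % 2 = n % 2) : TT w n M = 0 := by
  cases n with
  | zero => simp [TT]; omega
  | succ n =>
    simp only [TT]
    rw [if_neg (by omega)]

theorem TT_rec (w : ℕ → 𝕜) (n M : ℕ) :
    TT w (n + 1) (M + 2) = TT w (n + 1) M + w (M + 1) * TT w n (M + 1) := by
  by_cases h : M % 2 = n % 2
  · have h' : (M + 2) % 2 = n % 2 := by omega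
    simp only [TT, h, h', if_true]
    rw [Finset.sum_range_succ, Finset.sum_range_succ, TT_parity w n M h]
    ring
  · have h' : ¬ (M + 2) % 2 = n % 2 := by omega
    rw [TT_parity w n (M + 1) (by omega)]
    simp [TT, h, h']

theorem TT_rec0 (w : ℕ → 𝕜) (M : ℕ) : TT w 0 (M + 2) = TT w 0 M := by
  simp [TT]

def AA (w : ℕ → 𝕜) (M : ℕ) : 𝕜 := ∑ n ∈ Finset.range M, TT w n M

theorem AA_eq (w : ℕ → 𝕜) (M N : ℕ) (h : M ≤ N) : AA w M = ∑ n ∈ Finset.range N, TT w n M := by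
  refine Finset.sum_subset (Finset.range_mono h) fun n _ hn => ?_
  exact TT_zero_of_le w n M (by simpa using hn)

theorem AA_hasSum (w : ℕ → 𝕜) (M : ℕ) : HasSum (fun n => TT w n M) (AA w M) := by
  refine hasSum_sum_of_ne_finset_zero fun n hn => ?_
  exact TT_zero_of_le w n M (by simpa using hn)

theorem AA_rec (w : ℕ → 𝕜) (M : ℕ) : AA w (M + 2) = AA w M + w (M + 1) * AA w (M + 1) := by
  rw [AA_eq w (M + 2) (M + 2) le_rfl, AA_eq w M (M + 2) (by omega),
    AA_eq w (M + 1) (M + 1) le_rfl, Finset.sum_range_succ', Finset.sum_range_succ' _ (M + 1),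
    TT_rec0, Finset.mul_sum]
  simp only [TT_rec, Finset.sum_add_distrib]
  ring

theorem AA_zero (w : ℕ → 𝕜) : AA w 0 = 0 := by simp [AA]

theorem AA_one (w : ℕ → 𝕜) : AA w 1 = 1 := by simp [AA, TT]

theorem geo_hasSum (x : 𝕜) (hx : ‖x‖ < 1) (m : ℕ) :
    HasSum (fun k => x ^ k / (m : 𝕜) ^ (k + 2)) (1 / (m * (m - x))) := by
  rcases Nat.eq_zero_or_pos m with rfl | hm
  · simpa using (hasSum_zero : HasSum (fun _ : ℕ => (0 : 𝕜)) 0)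
  · have hm' : (1 : ℝ) ≤ m := by exact_mod_cast hm
    have hm0 : (m : 𝕜) ≠ 0 := by exact_mod_cast hm.ne'
    have hn : ‖x / m‖ < 1 := by
      rw [norm_div, RCLike.norm_natCast, div_lt_one (by linarith)]
      linarith
    have hne : (m : 𝕜) - x ≠ 0 := by
      intro h
      have : x = m := by linear_combination -h
      rw [this, RCLike.norm_natCast] at hx
      linarith
    refine hs_conv ((hasSum_geometric_of_norm_lt_one hn).mul_left (1 / (m : 𝕜) ^ 2))
      (fun k => ?_) ?_
    · rw [div_pow, pow_add]; field_simp
    · have : 1 - x / m = (m - x) / m := by field_simp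
      rw [this]; field_simp

theorem vW_hasSum (x t : 𝕜) (hx : ‖x‖ < 1) (m : ℕ) :
    HasSum (fun k => vW x t k m) (vS x t m) := by
  rw [← hasSum_nat_add_iff' 2]
  refine hs_conv ((geo_hasSum x hx m).mul_left (2 * t ^ m)) (fun k => ?_) ?_
  · simp [vW]; ring
  · simp [vW, vS, Finset.sum_range_succ, div_eq_mul_inv, mul_inv]; ring

theorem eW_hasSum (x y zz : 𝕜) (hx : ‖x‖ < 1) (m : ℕ) :
    HasSum (fun k => eW x y zz k m) (wS x y zz m) := by
  rw [← hasSum_nat_add_iff' 2]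
  refine hs_conv ((geo_hasSum x hx m).mul_left (2 * zz)) (fun k => ?_) ?_
  · simp [eW]; ring
  · simp [eW, wS, Finset.sum_range_succ, div_eq_mul_inv, mul_inv]

end chain



theorem norm_eW (x y zz : ℂ) (k m : ℕ) : ‖eW x y zz k m‖ = eW ‖x‖ ‖y‖ ‖zz‖ k m := by
  unfold eW
  split_ifs <;> simp

theorem norm_vW (x t : ℂ) (k m : ℕ) : ‖vW x t k m‖ = vW ‖x‖ ‖t‖ k m := by
  unfold vW
  split_ifs <;> simp

theorem norm_FF (x y zz : ℂ) (n M : ℕ) (q : (Fin n → ℕ) × (Fin n → ℕ)) :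
    ‖FF (eW x y zz) n M q‖ = FF (eW ‖x‖ ‖y‖ ‖zz‖) n M q := by
  unfold FF
  split_ifs
  · rw [norm_prod]; simp only [norm_eW]
  · simp

theorem wS_nonneg (x y zz : ℝ) (hx : x < 1 / 2) (hy : 0 ≤ y) (hzz : 0 ≤ zz) (m : ℕ) :
    0 ≤ wS x y zz m := by
  unfold wS
  rcases Nat.eq_zero_or_pos m with rfl | hm
  · simp
  · have hm' : (1 : ℝ) ≤ m := by exact_mod_cast hm
    have : 0 < (m : ℝ) - x := by linarith
    positivity

theorem wS_le (x y zz : ℝ) (hx : x < 1 / 2) (hy : 0 ≤ y) (hzz : 0 ≤ zz) (hy' : y < 1 / 4)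
    (hzz' : zz ≤ 1 / 16) (m : ℕ) : (m + 1 : ℕ) * wS x y zz (m + 1) ≤ 1 := by
  unfold wS
  push_cast
  have hm : (0 : ℝ) ≤ m := m.cast_nonneg
  have : 0 < (m : ℝ) + 1 - x := by linarith
  have e : ((m : ℝ) + 1) * (2 * y / (m + 1) + 2 * zz / ((m + 1) * (m + 1 - x)))
    = 2 * y + 2 * zz / (m + 1 - x) := by field_simp
  rw [e]
  have : 2 * zz / (m + 1 - x) ≤ 1 / 4 := by
    rw [div_le_iff₀ this]
    linarith
  linarith

theorem TT_nonneg (w : ℕ → ℝ) (hw : ∀ m, 0 ≤ w m) (n : ℕ) : ∀ M, 0 ≤ TT w n M := by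
  induction n with
  | zero => intro M; simp only [TT]; split_ifs <;> norm_num
  | succ n ih =>
    intro M
    simp only [TT]
    split_ifs
    · exact Finset.sum_nonneg fun m _ => mul_nonneg (hw m) (ih m)
    · rfl

theorem AA_le (w : ℕ → ℝ) (hw : ∀ m, 0 ≤ w m) (hw' : ∀ m : ℕ, (m + 1 : ℕ) * w (m + 1) ≤ 1)
    (M : ℕ) : AA w M ≤ M ∧ AA w (M + 1) ≤ (M + 1 : ℕ) := by
  induction M with
  | zero => simp [AA_zero, AA_one]
  | succ M ih =>
    refine ⟨ih.2, ?_⟩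
    rw [AA_rec]
    have h1 := mul_le_mul_of_nonneg_left ih.2 (hw (M + 1))
    have h2 := hw' M
    have h3 := ih.1
    push_cast at *
    nlinarith

theorem AA_nonneg (w : ℕ → ℝ) (hw : ∀ m, 0 ≤ w m) (M : ℕ) : 0 ≤ AA w M :=
  Finset.sum_nonneg fun n _ => TT_nonneg w hw n M

theorem vS_nonneg (x t : ℝ) (hx : x < 1 / 2) (ht : 0 ≤ t) (m : ℕ) : 0 ≤ vS x t m := by
  unfold vS
  rcases Nat.eq_zero_or_pos m with rfl | hm
  · simp
  · have hm' : (1 : ℝ) ≤ m := by exact_mod_cast hm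
    have : 0 < (m : ℝ) - x := by linarith
    positivity

theorem vS_le (x t : ℝ) (hx : x < 1 / 2) (ht : 0 ≤ t) (m : ℕ) : vS x t m * m ≤ 4 * t ^ m := by
  unfold vS
  rcases Nat.eq_zero_or_pos m with rfl | hm
  · simp
  · have hm' : (1 : ℝ) ≤ m := by exact_mod_cast hm
    have : 0 < (m : ℝ) - x := by linarith
    have e : 2 / (m * (m - x)) * t ^ m * m = 2 / (m - x) * t ^ m := by field_simp
    rw [e]
    refine mul_le_mul_of_nonneg_right ?_ (by positivity)
    rw [div_le_iff₀ this]
    linarith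

abbrev YY : Type := Σ p : ℕ × ℕ, ℕ × ((Fin p.2 → ℕ) × (Fin p.2 → ℕ))

abbrev XX : Type := Σ n : ℕ, (Fin (n + 1) → ℕ) × (Fin (n + 1) → ℕ)

def fY (x y zz t : ℂ) (a : YY) : ℂ := vW x t a.2.1 a.1.1 * FF (eW x y zz) a.1.2 a.1.1 a.2.2

theorem fY_in (x y zz t : ℂ) (hx1 : ‖x‖ < 1) (p : ℕ × ℕ) :
    HasSum (fun c => fY x y zz t ⟨p, c⟩) (vS x t p.1 * TT (wS x y zz) p.2 p.1) := by
  refine hs_conv (hasSum_mul' (vW_hasSum x t hx1 p.1)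
      (FF_hasSum _ _ (eW_hasSum x y zz hx1) p.2 p.1)) (fun c => ?_) rfl
  rw [fY]

theorem fY_in_norm (x y zz t : ℂ) (hx1 : ‖x‖ < 1) (p : ℕ × ℕ) :
    HasSum (fun c => ‖fY x y zz t ⟨p, c⟩‖)
      (vS ‖x‖ ‖t‖ p.1 * TT (wS ‖x‖ ‖y‖ ‖zz‖) p.2 p.1) := by
  have hx1' : ‖(‖x‖ : ℝ)‖ < 1 := by rwa [norm_norm]
  refine hs_conv (hasSum_mul' (vW_hasSum ‖x‖ ‖t‖ hx1' p.1)
      (FF_hasSum _ _ (eW_hasSum ‖x‖ ‖y‖ ‖zz‖ hx1') p.2 p.1)) (fun c => ?_) rfl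
  rw [fY, norm_mul, norm_vW, norm_FF]

theorem fY_sum_out (x y zz t : ℝ) (hx : x < 1 / 2) (hy : y < 1 / 4) (hzz : zz ≤ 1 / 16)
    (ht : t < 1) (hy0 : 0 ≤ y) (hzz0 : 0 ≤ zz) (ht0 : 0 ≤ t) :
    Summable (fun p : ℕ × ℕ => vS x t p.1 * TT (wS x y zz) p.2 p.1) := by
  have hw0 := wS_nonneg x y zz hx hy0 hzz0
  have hw1 := wS_le x y zz hx hy0 hzz0 hy hzz
  have hv0 := vS_nonneg x t hx ht0
  generalize wS x y zz = w' at *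
  rw [summable_prod_of_nonneg (fun p => mul_nonneg (hv0 _) (TT_nonneg _ hw0 _ _))]
  have h1 : ∀ M, HasSum (fun n => vS x t M * TT w' n M) (vS x t M * AA w' M) :=
    fun M => (AA_hasSum w' M).mul_left _
  refine ⟨fun M => (h1 M).summable, ?_⟩
  simp only [fun M => (h1 M).tsum_eq]
  refine Summable.of_nonneg_of_le (fun M => mul_nonneg (hv0 M) (AA_nonneg _ hw0 M)) (fun M => ?_)
    ((summable_geometric_of_lt_one ht0 ht).mul_left 4)
  exact (mul_le_mul_of_nonneg_left (AA_le w' hw0 hw1 M).1 (hv0 M)).trans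
    (vS_le _ _ hx ht0 M)

theorem fY_summable (x y zz t : ℂ) (hx : ‖x‖ < 1 / 2) (hy : ‖y‖ < 1 / 4) (hzz : ‖zz‖ ≤ 1 / 16)
    (ht : ‖t‖ < 1) : Summable (fY x y zz t) := by
  have hx1 : ‖x‖ < 1 := by linarith
  refine Summable.of_norm ?_
  rw [summable_sigma_of_nonneg (fun _ => norm_nonneg _)]
  refine ⟨fun p => (fY_in_norm x y zz t hx1 p).summable, ?_⟩
  have := fY_sum_out ‖x‖ ‖y‖ ‖zz‖ ‖t‖ hx hy hzz ht (norm_nonneg _) (norm_nonneg _) (norm_nonneg _)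
  refine this.congr fun p => ?_
  exact (fY_in_norm x y zz t hx1 p).tsum_eq.symm

theorem vA_hasSum (x y zz t : ℂ) (hx : ‖x‖ < 1 / 2) (hy : ‖y‖ < 1 / 4) (hzz : ‖zz‖ ≤ 1 / 16)
    (ht : ‖t‖ < 1) :
    HasSum (fun M => vS x t M * AA (wS x y zz) M) (∑' a, fY x y zz t a) := by
  have hx1 : ‖x‖ < 1 := by linarith
  have h2 : HasSum (fun p : ℕ × ℕ => vS x t p.1 * TT (wS x y zz) p.2 p.1) (∑' a, fY x y zz t a) :=
    (fY_summable x y zz t hx hy hzz ht).hasSum.sigma (fun p => fY_in x y zz t hx1 p)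
  refine h2.prod_fiberwise (fun M => ?_)
  exact (AA_hasSum (wS x y zz) M).mul_left (vS x t M)

theorem fY_hasSum (x y zz t : ℂ) (hx : ‖x‖ < 1 / 2) (hy : ‖y‖ < 1 / 4) (hzz : ‖zz‖ ≤ 1 / 16)
    (ht : ‖t‖ < 1) :
    HasSum (fY x y zz t) (∑' M, vS x t M * AA (wS x y zz) M) := by
  rw [(vA_hasSum x y zz t hx hy hzz ht).tsum_eq]
  exact (fY_summable x y zz t hx hy hzz ht).hasSum

def eYX : YY ≃ XX where
  toFun a := ⟨a.1.2, (Fin.snoc (α := fun _ => ℕ) a.2.2.1 a.2.1,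
    Fin.snoc (α := fun _ => ℕ) a.2.2.2 a.1.1)⟩
  invFun b := ⟨(b.2.2 (Fin.last b.1), b.1), (b.2.1 (Fin.last b.1), fun i => b.2.1 i.castSucc,
    fun i => b.2.2 i.castSucc)⟩
  left_inv a := by
    rcases a with ⟨⟨M, n⟩, k, κ, μ⟩
    simp
  right_inv b := by
    rcases b with ⟨n, κ, μ⟩
    refine Sigma.ext rfl (heq_of_eq ?_)
    refine Prod.ext ?_ ?_
    · funext i
      refine Fin.lastCases ?_ (fun i => ?_) i <;> simp
    · funext i
      refine Fin.lastCases ?_ (fun i => ?_) i <;> simp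

def fX (x y zz t : ℂ) (n : ℕ) (κ m : Fin (n + 1) → ℕ) : ℂ :=
  if athCond (n + 1) m then vW x t (κ (Fin.last n)) (m (Fin.last n)) *
    ∏ i : Fin n, eW x y zz (κ i.castSucc) (m i.castSucc) else 0

theorem fX_hasSum (x y zz t : ℂ) (hx : ‖x‖ < 1 / 2) (hy : ‖y‖ < 1 / 4) (hzz : ‖zz‖ ≤ 1 / 16)
    (ht : ‖t‖ < 1) :
    HasSum (fun b : XX => fX x y zz t b.1 b.2.1 b.2.2)
      (∑' M, vS x t M * AA (wS x y zz) M) := by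
  rw [← eYX.hasSum_iff]
  refine hs_conv (fY_hasSum x y zz t hx hy hzz ht) (fun a => ?_) rfl
  simp only [Function.comp, eYX, Equiv.coe_fn_mk, fX, fY, FF, Fin.snoc_last, Fin.snoc_castSucc]
  split_ifs
  · rfl
  · rw [mul_zero]



def hh (k : ℕ) : ℕ := if 2 ≤ k then 1 else 0

theorem eW_form (x y z : ℂ) (k m : ℕ) (hk : 1 ≤ k) : eW x y (z ^ 2) k m =
    2 * x ^ (k - 1 - hh k) * y ^ (1 - hh k) * (z ^ 2) ^ hh k * ((m : ℂ) ^ k)⁻¹ := by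
  unfold eW hh
  rw [if_neg (by omega)]
  by_cases h : k = 1
  · subst h
    simp [div_eq_mul_inv]
  · rw [if_neg h, if_pos (by omega)]
    have : k - 1 - 1 = k - 2 := by omega
    rw [this]
    rw [div_eq_mul_inv, Nat.sub_self, pow_zero, pow_one]
    ring

theorem prod_form (x y z : ℂ) (n : ℕ) (κ m : Fin n → ℕ) (hκ : ∀ i, 1 ≤ κ i) :
    ∏ i, eW x y (z ^ 2) (κ i) (m i) = 2 ^ n * x ^ (∑ i, (κ i - 1 - hh (κ i)))
      * y ^ (∑ i, (1 - hh (κ i))) * (z ^ 2) ^ (∑ i, hh (κ i)) * (∏ i, (m i : ℂ) ^ κ i)⁻¹ := by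
  rw [Finset.prod_congr rfl fun i _ => eW_form x y z (κ i) (m i) (hκ i)]
  rw [Finset.prod_mul_distrib, Finset.prod_mul_distrib, Finset.prod_mul_distrib,
    Finset.prod_mul_distrib, Finset.prod_pow_eq_pow_sum, Finset.prod_pow_eq_pow_sum,
    Finset.prod_pow_eq_pow_sum, Finset.prod_inv_distrib]
  simp

theorem hh_le (k : ℕ) : hh k ≤ 1 := by unfold hh; split_ifs <;> simp

theorem hh_le' (k : ℕ) (hk : 1 ≤ k) : 1 + hh k ≤ k := by unfold hh; split_ifs <;> omega

theorem card_hh (n : ℕ) (κ : Fin n → ℕ) :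
    (Finset.univ.filter fun i => 2 ≤ κ i).card = ∑ i, hh (κ i) := by
  rw [Finset.card_filter]; rfl

theorem fX_form (x y z t : ℂ) (n : ℕ) (κ m : Fin (n + 1) → ℕ) (hκ : ∀ i, 1 ≤ κ i)
    (hl : 2 ≤ κ (Fin.last n)) (K S : ℕ) (hK : ∑ i, κ i = K)
    (hS : (Finset.univ.filter fun i => 2 ≤ κ i).card = S) :
    fX x y (z ^ 2) t n κ m = 2 ^ (n + 1) * x ^ (K - (n + 1) - S) * y ^ (n + 1 - S)
      * z ^ (2 * (S - 1)) * (if athCond (n + 1) m then t ^ lastExp m / ∏ i, ((m i : ℂ) ^ κ i)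
        else 0) := by
  unfold fX
  split_ifs with h
  · have hle : lastExp m = m (Fin.last n) := by simp [lastExp]; rfl
    rw [prod_form _ _ _ _ _ _ (fun i => hκ _), hle, Fin.prod_univ_castSucc]
    rw [card_hh, Fin.sum_univ_castSucc] at hS
    rw [Fin.sum_univ_castSucc] at hK
    have h1 : hh (κ (Fin.last n)) = 1 := by simp [hh, hl]
    have hA : ∑ i : Fin n, (κ i.castSucc - 1 - hh (κ i.castSucc)) + n
        + ∑ i : Fin n, hh (κ i.castSucc) = ∑ i : Fin n, κ i.castSucc := by
      have e : ∀ i : Fin n, κ i.castSucc = (κ i.castSucc - 1 - hh (κ i.castSucc)) + 1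
          + hh (κ i.castSucc) := fun i => by
        have := hh_le' _ (hκ i.castSucc)
        omega
      rw [Finset.sum_congr rfl fun i _ => e i, Finset.sum_add_distrib, Finset.sum_add_distrib]
      simp
    have hB : ∑ i : Fin n, (1 - hh (κ i.castSucc)) + ∑ i : Fin n, hh (κ i.castSucc) = n := by
      rw [← Finset.sum_add_distrib, Finset.sum_congr rfl fun i _ =>
        Nat.sub_add_cancel (hh_le (κ i.castSucc))]
      simp
    generalize ∑ i : Fin n, (κ i.castSucc - 1 - hh (κ i.castSucc)) = a at *
    generalize ∑ i : Fin n, (1 - hh (κ i.castSucc)) = b at *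
    generalize ∑ i : Fin n, hh (κ i.castSucc) = c at *
    rw [h1] at hS
    have e1 : K - (n + 1) - S = a + (κ (Fin.last n) - 2) := by omega
    have e2 : n + 1 - S = b := by omega
    have e3 : S - 1 = c := by omega
    rw [e1, e2, e3, vW, if_neg (by omega), pow_add, pow_succ, pow_mul, div_eq_mul_inv,
      div_eq_mul_inv, mul_inv]
    ring
  · simp

theorem fX_zero (x y zz t : ℂ) (n : ℕ) (κ m : Fin (n + 1) → ℕ)
    (h : ¬ ((∀ i, 1 ≤ κ i) ∧ 2 ≤ κ (Fin.last n))) : fX x y zz t n κ m = 0 := by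
  unfold fX
  split_ifs with h'
  · by_cases hl : 2 ≤ κ (Fin.last n)
    · have : ∃ i : Fin n, κ i.castSucc = 0 := by
        by_contra hc
        push Not at hc
        refine h ⟨fun i => ?_, hl⟩
        refine Fin.lastCases (by omega) (fun i => ?_) i
        exact Nat.one_le_iff_ne_zero.mpr (hc i)
      obtain ⟨i, hi⟩ := this
      rw [Finset.prod_eq_zero (Finset.mem_univ i) (by simp [eW, hi]), mul_zero]
    · rw [vW, if_pos (by omega), zero_mul]
  · rfl

def phiX (b : XX) : ℕ × ℕ × ℕ :=
  (∑ i, b.2.1 i, b.1 + 1, (Finset.univ.filter fun i => 2 ≤ b.2.1 i).card)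

theorem idx_iff (K n S : ℕ) (κ : Fin (n + 1) → ℕ) : IdxCond0 K (n + 1) S κ ↔
    (((∀ i, 1 ≤ κ i) ∧ 2 ≤ κ (Fin.last n)) ∧ ∑ i, κ i = K ∧
      (Finset.univ.filter fun i => 2 ≤ κ i).card = S) := by
  have : (∀ h : 0 < n + 1, 2 ≤ κ ⟨n + 1 - 1, Nat.sub_lt h Nat.one_pos⟩) ↔ 2 ≤ κ (Fin.last n) :=
    ⟨fun h => h (Nat.succ_pos n), fun h _ => h⟩
  unfold IdxCond0 IdxCond
  rw [this]
  tauto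

theorem fiber_eq (x y z t : ℂ) (K n S : ℕ)
    (hs : Summable (fun b : XX => fX x y (z ^ 2) t b.1 b.2.1 b.2.2)) :
    ∑' b : phiX ⁻¹' {(K, n + 1, S)}, fX x y (z ^ 2) t b.1.1 b.1.2.1 b.1.2.2
      = 2 ^ (n + 1) * (∑' κ : Fin (n + 1) → ℕ, if IdxCond0 K (n + 1) S κ then Ath κ t else 0)
        * x ^ (K - (n + 1) - S) * y ^ (n + 1 - S) * z ^ (2 * (S - 1)) := by
  rw [tsum_subtype (phiX ⁻¹' {(K, n + 1, S)}) (fun b : XX => fX x y (z ^ 2) t b.1 b.2.1 b.2.2)]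
  have hs' := hs.indicator (phiX ⁻¹' {(K, n + 1, S)})
  have hinj : Function.Injective
      (fun q : (Fin (n + 1) → ℕ) × (Fin (n + 1) → ℕ) => (⟨n, q⟩ : XX)) := by
    intro a b h
    simpa using h
  have hs2 := hs'.comp_injective hinj
  rw [← hinj.tsum_eq]
  · refine Eq.trans (Summable.tsum_prod hs2) ?_
    have hκ : ∀ κ : Fin (n + 1) → ℕ, ∑' m : Fin (n + 1) → ℕ,
        (phiX ⁻¹' {(K, n + 1, S)}).indicator
          (fun b : XX => fX x y (z ^ 2) t b.1 b.2.1 b.2.2) ⟨n, (κ, m)⟩ =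
        (2 ^ (n + 1) * x ^ (K - (n + 1) - S) * y ^ (n + 1 - S) * z ^ (2 * (S - 1))) *
          (if IdxCond0 K (n + 1) S κ then Ath κ t else 0) := by
      intro κ
      split_ifs with h
      · rw [idx_iff] at h
        rw [Ath, ← tsum_mul_left]
        refine tsum_congr fun m => ?_
        rw [Set.indicator_of_mem, fX_form x y z t n κ m h.1.1 h.1.2 K S h.2.1 h.2.2]
        simp only [phiX, Set.mem_preimage, Set.mem_singleton_iff, h.2.1, h.2.2]
      · rw [mul_zero]
        refine (tsum_congr fun m => ?_).trans tsum_zero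
        rw [Set.indicator_apply]
        split_ifs with hm
        · refine fX_zero _ _ _ _ _ _ _ fun hc => h ?_
          rw [idx_iff]
          simp only [phiX, Set.mem_preimage, Set.mem_singleton_iff, Prod.mk.injEq] at hm
          exact ⟨hc, hm.1, hm.2.2⟩
        · rfl
    refine Eq.trans (tsum_congr hκ) ?_
    rw [tsum_mul_left]
    ring
  · intro b hb
    have : b ∈ phiX ⁻¹' {(K, n + 1, S)} := by
      by_contra hc
      exact hb (Set.indicator_of_notMem hc _)
    simp only [phiX, Set.mem_preimage, Set.mem_singleton_iff, Prod.mk.injEq] at this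
    obtain ⟨n', q⟩ := b
    have h : n' = n := by simpa using this.2.1
    subst h
    exact ⟨q, rfl⟩

theorem fiber_phi (x y z t : ℂ) (p : ℕ × ℕ × ℕ)
    (hs : Summable (fun b : XX => fX x y (z ^ 2) t b.1 b.2.1 b.2.2)) :
    ∑' b : phiX ⁻¹' {p}, fX x y (z ^ 2) t b.1.1 b.1.2.1 b.1.2.2 = Phi0Term x y z p t := by
  obtain ⟨K, n, S⟩ := p
  cases n with
  | zero =>
    have : IsEmpty (phiX ⁻¹' {(K, 0, S)}) := ⟨fun b => by
      have h1 : phiX b.1 = (K, 0, S) := b.2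
      have h2 : b.1.1 + 1 = 0 := congrArg (fun q => q.2.1) h1
      omega⟩
    rw [tsum_empty]
    simp [Phi0Term]
  | succ n =>
    rw [fiber_eq _ _ _ _ _ _ _ hs]
    unfold Phi0Term
    split_ifs with h
    · rfl
    · have : ∀ κ : Fin (n + 1) → ℕ, (if IdxCond0 K (n + 1) S κ then Ath κ t else 0) = 0 := by
        intro κ
        rw [if_neg]
        intro hc
        rw [idx_iff] at hc
        refine h ⟨?_, by simp, ?_⟩
        · rw [← hc.2.1]
          exact (hc.1.1 (Fin.last n)).trans
            (Finset.single_le_sum (f := κ) (fun i _ => Nat.zero_le _) (Finset.mem_univ _))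
        · rw [← hc.2.2]
          change 0 < (Finset.univ.filter fun i => 2 ≤ κ i).card
          refine (Finset.card_pos.mpr ?_)
          refine ⟨Fin.last n, ?_⟩
          simpa using hc.1.2
      rw [tsum_congr this, tsum_zero]
      simp

theorem Phi0_eq (x y z t : ℂ) (hx : ‖x‖ < 1 / 2) (hy : ‖y‖ < 1 / 4) (hzz : ‖z ^ 2‖ ≤ 1 / 16)
    (ht : ‖t‖ < 1) : Phi0 x y z t = ∑' M, vS x t M * AA (wS x y (z ^ 2)) M := by
  have h := fX_hasSum x y (z ^ 2) t hx hy hzz ht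
  have h2 := h.tsum_fiberwise phiX
  rw [← h2.tsum_eq, Phi0]
  exact tsum_congr fun p => (fiber_phi x y z t p h.summable).symm

theorem sub_ne (x : ℂ) (hrex : x.re < 0) (M : ℕ) : (M : ℂ) - x ≠ 0 := by
  intro h
  have := congrArg Complex.re h
  simp at this
  have := M.cast_nonneg (α := ℝ)
  linarith

theorem uHc_AA (x y : ℂ) (hrex : x.re < 0) (M : ℕ) :
    (M : ℂ) * uHc x y M = y * AA (wS x y (x * y / 2)) M ∧
    ((M + 1 : ℕ) : ℂ) * uHc x y (M + 1) = y * AA (wS x y (x * y / 2)) (M + 1) := by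
  induction M with
  | zero => simp [AA_zero, AA_one, uHc_one]
  | succ M ih =>
    refine ⟨ih.2, ?_⟩
    have h1 := uHc_rec x y hrex M
    have h2 := sub_ne x hrex (M + 1)
    have h3 : (M : ℂ) + 1 ≠ 0 := Nat.cast_add_one_ne_zero M
    have hw : (M + 1 - x) * (wS x y (x * y / 2) (M + 1) * (M + 1)) = y * (2 * (M + 1) - x) := by
      unfold wS
      push_cast at h2 ⊢
      field_simp
      ring
    rw [AA_rec, mul_add, ← ih.1]
    have e : y * (wS x y (x * y / 2) (M + 1) * AA (wS x y (x * y / 2)) (M + 1))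
      = wS x y (x * y / 2) (M + 1) * (((M + 1 : ℕ) : ℂ) * uHc x y (M + 1)) := by
      rw [ih.2]; ring
    rw [e]
    refine mul_left_cancel₀ h2 ?_
    push_cast
    linear_combination h1 - uHc x y (M + 1) * hw

theorem u_series (x y z : ℂ) (hrex : x.re < 0)
    (hx : ‖x‖ < 1 / 2) (hy : ‖y‖ < 1 / 4) (hz : z ^ 2 = x * y / 2)
    (t : ℝ) (ht0 : 0 < t) (ht1 : t < 1) :
    1 - x * y / 2 * Phi0 x y z t = -x * ∑' M : ℕ, uHc x y M * (t : ℂ) ^ M / (M - x) := by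
  have hzz : ‖z ^ 2‖ ≤ 1 / 16 := by
    rw [hz, norm_div, norm_mul]
    have : ‖x‖ * ‖y‖ ≤ 1 / 2 * (1 / 4) := by gcongr
    norm_num
    linarith
  have hnt : ‖(t : ℂ)‖ < 1 := by
    rw [Complex.norm_real, Real.norm_of_nonneg ht0.le]; linarith
  rw [Phi0_eq x y z t hx hy hzz hnt]
  have h1 := (vA_hasSum x y (z ^ 2) t hx hy hzz hnt).summable.hasSum.mul_left (x * y / 2)
  have h2 : HasSum (fun M : ℕ => if M = 0 then (1 : ℂ) else 0) 1 := hasSum_ite_eq 0 1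
  rw [← (h2.sub h1).tsum_eq, ← tsum_mul_left]
  refine tsum_congr fun M => ?_
  have h3 := (uHc_AA x y hrex M).1
  have h4 := sub_ne x hrex M
  rw [hz]
  cases M with
  | zero =>
    have : x ≠ 0 := by
      rintro rfl
      simp at hrex
    simp [vS, uHc_zero, this]
  | succ M =>
    have h5 : ((M + 1 : ℕ) : ℂ) ≠ 0 := Nat.cast_ne_zero.mpr (Nat.succ_ne_zero M)
    rw [if_neg (Nat.succ_ne_zero M), vS]
    generalize ((M + 1 : ℕ) : ℂ) = c at *
    have h6 : uHc x y (M + 1) = y * AA (wS x y (x * y / 2)) (M + 1) / c := by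
      rw [eq_div_iff h5, ← h3]; ring
    rw [h6]
    field_simp
    ring


/-- Integral and series representation of `u(t) = 1 − (xy/2) Φ₀(x,y,z;t)` for
real `0 < t < 1`, under `Re x < 0` and `0 < Re y < 1`, with `z² = xy/2`. -/
theorem u_integral_and_series (x y z : ℂ) (hrex : x.re < 0)
    (hrey0 : 0 < y.re) (hrey1 : y.re < 1)
    (hx : ‖x‖ < 1 / 2) (hy : ‖y‖ < 1 / 4) (hz : z ^ 2 = x * y / 2)
    (t : ℝ) (ht0 : 0 < t) (ht1 : t < 1) :
    1 - x * y / 2 * Phi0 x y z t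
        = -x * (t : ℂ) ^ x
            * ∫ s in (0 : ℝ)..t, ((s : ℂ) ^ (-1 - x) * (1 - (s : ℂ)) ^ (-y)
                * hypF (-y / 2) ((1 - x - y) / 2) ((1 - x) / 2) ((s : ℂ) ^ 2)) ∧
    1 - x * y / 2 * Phi0 x y z t
        = -x * ∑' m : ℕ, (t : ℂ) ^ (2 * m)
            * (poch (-y / 2) m * poch ((1 - x - y) / 2) m
                / ((m.factorial : ℂ) * poch ((1 - x) / 2) m))
            * ∫ s in (0 : ℝ)..1,
                ((s : ℂ) ^ (2 * (m : ℂ) - 1 - x) * (1 - (t : ℂ) * (s : ℂ)) ^ (-y)) := by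
  have h := u_series x y z hrex hx hy hz t ht0 ht1
  refine ⟨?_, ?_⟩
  · rw [h, (rhs_one x y hrex hy t ht0 ht1).tsum_eq, mul_assoc]
  · rw [h, rhs_two x y hrex hy t ht0 ht1]

end
end

section
/- Let x, y be complex numbers with Re x < 0, 0 < Re y < 1, |x| < 1/2, |y| < 1/4, x ≠ 0, y ≠ 0, and set z² = xy/2. Let u(t) = 1 − (xy/2) Φ₀(x,y,z;t) for t ∈ [0,1). Then lim_{t→1⁻} u(t) = ( Γ(1−x) Γ(1−y) / Γ(1−x−y) ) · ( Γ(1−(x+y)/2) / ( Γ(1−x/2) Γ(1−y/2) ) ). -/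
open Complex Filter Metric Finset

attribute [local instance] Classical.propDecidable

noncomputable section

/-- kernel base -/
def Rk (t s : ℝ) : ℝ := (1 + t) ^ 2 - 4 * t * s

lemma Rk_pos {t s : ℝ} (ht : t ∈ Set.Ioo (-1 : ℝ) 1) (hs : s ∈ Set.Icc (0 : ℝ) 1) : 0 < Rk t s := by
  have h : Rk t s = (1 - s) * (1 + t) ^ 2 + s * (1 - t) ^ 2 := by unfold Rk; ring
  obtain ⟨h1, h2⟩ := ht
  obtain ⟨h3, h4⟩ := hs
  have h5 : 0 < (1 + t) ^ 2 := by apply pow_pos; linarith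
  have h6 : 0 < (1 - t) ^ 2 := by apply pow_pos; linarith
  rw [h]
  rcases eq_or_lt_of_le h3 with h7 | h7
  · subst h7; simpa using h5
  · have := mul_pos h7 h6
    have := mul_nonneg (sub_nonneg.2 h4) h5.le
    linarith

lemma Rk_slit {t s : ℝ} (ht : t ∈ Set.Ioo (-1 : ℝ) 1) (hs : s ∈ Set.Icc (0 : ℝ) 1) :
    ((Rk t s : ℝ) : ℂ) ∈ slitPlane := by
  rw [ofReal_mem_slitPlane]; exact Rk_pos ht hs

lemma Rk_cont : Continuous (fun p : ℝ × ℝ => ((Rk p.1 p.2 : ℝ) : ℂ)) := by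
  unfold Rk; fun_prop

lemma Rk_cpow_contOn (c : ℂ) : ContinuousOn (fun p : ℝ × ℝ => ((Rk p.1 p.2 : ℝ) : ℂ) ^ c)
    (Set.Ioo (-1 : ℝ) 1 ×ˢ Set.Icc (0 : ℝ) 1) := by
  apply ContinuousOn.cpow_const Rk_cont.continuousOn
  intro p hp
  exact Rk_slit hp.1 hp.2

lemma Rk_hasDeriv_t (c : ℂ) {t s : ℝ} (ht : t ∈ Set.Ioo (-1 : ℝ) 1) (hs : s ∈ Set.Icc (0 : ℝ) 1) :
    HasDerivAt (fun t : ℝ => ((Rk t s : ℝ) : ℂ) ^ c)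
      (c * ((Rk t s : ℝ) : ℂ) ^ (c - 1) * (2 * (1 + t) - 4 * s)) t := by
  have h1 : HasDerivAt (fun t : ℂ => (1 + t) ^ 2 - 4 * t * s) (2 * (1 + t) - 4 * s : ℂ) (t : ℂ) := by
    have := (((hasDerivAt_id (t : ℂ)).const_add 1).pow 2).sub
      (((hasDerivAt_id (t : ℂ)).const_mul 4).mul_const (s : ℂ))
    exact this.congr_deriv (by simp)
  have hsl := Rk_slit ht hs
  have e : ((Rk t s : ℝ) : ℂ) = (1 + (t : ℂ)) ^ 2 - 4 * t * s := by unfold Rk; push_cast; ring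
  rw [e] at hsl
  have h2 := (h1.cpow_const (c := c) hsl).comp_ofReal
  rw [e]
  convert h2 using 1
  ext u
  unfold Rk; push_cast; rfl

lemma Rk_hasDeriv_s (c : ℂ) {t s : ℝ} (ht : t ∈ Set.Ioo (-1 : ℝ) 1) (hs : s ∈ Set.Icc (0 : ℝ) 1) :
    HasDerivAt (fun s : ℝ => ((Rk t s : ℝ) : ℂ) ^ c)
      (c * ((Rk t s : ℝ) : ℂ) ^ (c - 1) * (- 4 * t)) s := by
  have h1 : HasDerivAt (fun s : ℂ => (1 + (t : ℂ)) ^ 2 - 4 * t * s) (- 4 * t : ℂ) (s : ℂ) := by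
    have := ((hasDerivAt_id (s : ℂ)).const_mul (4 * (t : ℂ))).const_sub ((1 + (t : ℂ)) ^ 2)
    exact this.congr_deriv (by simp)
  have hsl := Rk_slit ht hs
  have e : ((Rk t s : ℝ) : ℂ) = (1 + (t : ℂ)) ^ 2 - 4 * t * s := by unfold Rk; push_cast; ring
  rw [e] at hsl
  have h2 := (h1.cpow_const (c := c) hsl).comp_ofReal
  rw [e]
  convert h2 using 1
  ext u
  unfold Rk; push_cast; rfl

lemma param_deriv {W : ℝ → ℂ} (hW : IntervalIntegrable W MeasureTheory.volume 0 1)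
    {k k' : ℝ → ℝ → ℂ}
    (hk : ∀ t ∈ Set.Ioo (-1 : ℝ) 1, ∀ s ∈ Set.Icc (0 : ℝ) 1, HasDerivAt (fun t => k t s) (k' t s) t)
    (hkc : ∀ t ∈ Set.Ioo (-1 : ℝ) 1, ContinuousOn (k t) (Set.Icc (0 : ℝ) 1))
    (hk'c : ContinuousOn (fun p : ℝ × ℝ => k' p.1 p.2) (Set.Ioo (-1 : ℝ) 1 ×ˢ Set.Icc (0 : ℝ) 1))
    {t0 : ℝ} (ht0 : t0 ∈ Set.Ioo (-1 : ℝ) 1) :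
    HasDerivAt (fun t => ∫ s in (0 : ℝ)..1, W s * k t s) (∫ s in (0 : ℝ)..1, W s * k' t0 s) t0 := by
  obtain ⟨a, ha1, ha2⟩ := exists_between ht0.1
  obtain ⟨b, hb1, hb2⟩ := exists_between ht0.2
  have hsub : Set.Icc a b ⊆ Set.Ioo (-1 : ℝ) 1 := fun u hu => ⟨by linarith [hu.1], by linarith [hu.2]⟩
  have hcomp : IsCompact (Set.Icc a b ×ˢ Set.Icc (0 : ℝ) 1) := isCompact_Icc.prod isCompact_Icc
  obtain ⟨C, hC⟩ := hcomp.exists_bound_of_continuousOn (hk'c.mono (Set.prod_mono hsub le_rfl))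
  have hu : Set.uIoc (0 : ℝ) 1 = Set.Ioc 0 1 := Set.uIoc_of_le zero_le_one
  have hin : Set.uIoc (0 : ℝ) 1 ⊆ Set.Icc 0 1 := by rw [hu]; exact Set.Ioc_subset_Icc_self
  have huI : Set.uIcc (0 : ℝ) 1 = Set.Icc 0 1 := Set.uIcc_of_le zero_le_one
  have hint : ∀ t ∈ Set.Ioo (-1 : ℝ) 1,
      IntervalIntegrable (fun s => W s * k t s) MeasureTheory.volume 0 1 := by
    intro t ht
    apply hW.mul_continuousOn
    rw [huI]; exact hkc t ht
  have hint' : IntervalIntegrable (fun s => W s * k' t0 s) MeasureTheory.volume 0 1 := by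
    apply hW.mul_continuousOn
    rw [huI]
    exact hk'c.comp (f := fun s : ℝ => (t0, s)) (by fun_prop) (fun s hs => ⟨ht0, hs⟩)
  refine (intervalIntegral.hasDerivAt_integral_of_dominated_loc_of_deriv_le
    (bound := fun s => ‖W s‖ * C) (F := fun t s => W s * k t s) (F' := fun t s => W s * k' t s) (Icc_mem_nhds ha2 hb1) ?_ (hint t0 ht0) ?_ ?_ ?_ ?_).2
  · filter_upwards [Ioo_mem_nhds ht0.1 ht0.2] with t ht
    exact (hint t ht).def'.aestronglyMeasurable
  · exact hint'.def'.aestronglyMeasurable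
  · refine Filter.Eventually.of_forall fun s hs t ht => ?_
    rw [norm_mul]
    exact mul_le_mul_of_nonneg_left (hC (t, s) ⟨ht, hin hs⟩) (norm_nonneg _)
  · exact hW.norm.mul_const C
  · refine Filter.Eventually.of_forall fun s hs t ht => ?_
    exact (hk t (hsub ht) s (hin hs)).const_mul _

/-- weight -/
def Wt (x y : ℂ) (s : ℝ) : ℂ := (s : ℂ) ^ ((1 + y - x) / 2 - 1) * (1 - (s : ℂ)) ^ ((1 - x - y) / 2 - 1)

def Ju (x y : ℂ) (t : ℝ) : ℂ := ∫ s in (0 : ℝ)..1, Wt x y s * ((Rk t s : ℝ) : ℂ) ^ (x / 2)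
def Jr (x y : ℂ) (t : ℝ) : ℂ := ∫ s in (0 : ℝ)..1, Wt x y s * ((Rk t s : ℝ) : ℂ) ^ (x / 2 - 1)
def Jv (x y : ℂ) (t : ℝ) : ℂ :=
  ∫ s in (0 : ℝ)..1, Wt x y s * (t * (2 * s - 1 - t) * ((Rk t s : ℝ) : ℂ) ^ (x / 2 - 1))
def Jw (x y : ℂ) (t : ℝ) : ℂ :=
  ∫ s in (0 : ℝ)..1, Wt x y s * ((2 * s - 1 - 2 * t) * ((Rk t s : ℝ) : ℂ) ^ (x / 2 - 1)
    + t * (2 * s - 1 - t) * ((x / 2 - 1) * ((Rk t s : ℝ) : ℂ) ^ (x / 2 - 1 - 1) * (2 * (1 + t) - 4 * s)))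
def Jz (x y : ℂ) (t : ℝ) : ℂ :=
  ∫ s in (0 : ℝ)..1, Wt x y s * ((x / 2) * ((Rk t s : ℝ) : ℂ) ^ (x / 2 - 1) * (2 * (1 + t) - 4 * s))

section
variable {x y : ℂ} (hb : 0 < (((1 + y - x) / 2 : ℂ)).re) (hd : 0 < (((1 - x - y) / 2 : ℂ)).re)
include hb hd

lemma Wt_int : IntervalIntegrable (Wt x y) MeasureTheory.volume 0 1 := betaIntegral_convergent hb hd

lemma Ju_deriv {t : ℝ} (ht : t ∈ Set.Ioo (-1 : ℝ) 1) : HasDerivAt (Ju x y) (Jz x y t) t := by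
  refine param_deriv (Wt_int hb hd) (k := fun t s => ((Rk t s : ℝ) : ℂ) ^ (x / 2))
    (k' := fun t s => (x / 2) * ((Rk t s : ℝ) : ℂ) ^ (x / 2 - 1) * (2 * (1 + t) - 4 * s)) ?_ ?_ ?_ ht
  · intro t ht s hs; exact Rk_hasDeriv_t _ ht hs
  · intro t ht
    exact (Rk_cpow_contOn (x / 2)).comp (f := fun s : ℝ => (t, s)) (by fun_prop) (fun s hs => ⟨ht, hs⟩)
  · have := Rk_cpow_contOn (x / 2 - 1)
    fun_prop

lemma Jv_deriv {t : ℝ} (ht : t ∈ Set.Ioo (-1 : ℝ) 1) : HasDerivAt (Jv x y) (Jw x y t) t := by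
  refine param_deriv (Wt_int hb hd)
    (k := fun t s => t * (2 * s - 1 - t) * ((Rk t s : ℝ) : ℂ) ^ (x / 2 - 1))
    (k' := fun t s => (2 * s - 1 - 2 * t) * ((Rk t s : ℝ) : ℂ) ^ (x / 2 - 1)
    + t * (2 * s - 1 - t) * ((x / 2 - 1) * ((Rk t s : ℝ) : ℂ) ^ (x / 2 - 1 - 1) * (2 * (1 + t) - 4 * s)))
     ?_ ?_ ?_ ht
  · intro t ht s hs
    have h1 : HasDerivAt (fun t : ℝ => (t : ℂ) * (2 * s - 1 - t)) (2 * s - 1 - 2 * t : ℂ) t := by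
      have h0 : HasDerivAt (fun t : ℝ => (t : ℂ)) 1 t := Complex.ofRealCLM.hasDerivAt
      have := h0.mul (h0.const_sub (2 * (s : ℂ) - 1))
      exact this.congr_deriv (by ring)
    exact h1.mul (Rk_hasDeriv_t _ ht hs)
  · intro t ht
    have := (Rk_cpow_contOn (x / 2 - 1)).comp (f := fun s : ℝ => (t, s)) (s := Set.Icc (0:ℝ) 1)
      (by fun_prop) (fun s hs => ⟨ht, hs⟩)
    apply ContinuousOn.mul
    · fun_prop
    · exact this
  · have h1 := Rk_cpow_contOn (x / 2 - 1)
    have h2 := Rk_cpow_contOn (x / 2 - 1 - 1)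
    fun_prop

lemma int_aux {k : ℝ → ℂ} (hk : ContinuousOn k (Set.Icc 0 1)) :
    IntervalIntegrable (fun s => Wt x y s * k s) MeasureTheory.volume 0 1 := by
  apply (Wt_int hb hd).mul_continuousOn
  rwa [Set.uIcc_of_le zero_le_one]

lemma Rk_cpow_contOn' (c : ℂ) {t : ℝ} (ht : t ∈ Set.Ioo (-1 : ℝ) 1) :
    ContinuousOn (fun s : ℝ => ((Rk t s : ℝ) : ℂ) ^ c) (Set.Icc (0 : ℝ) 1) := by
  have := (Rk_cpow_contOn c).comp (f := fun s : ℝ => (t, s)) (s := Set.Icc (0:ℝ) 1)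
      (by fun_prop) (fun s hs => ⟨ht, hs⟩)
  exact this

lemma J_rel1 {t : ℝ} (ht : t ∈ Set.Ioo (-1 : ℝ) 1) : t * Jz x y t = - x * Jv x y t := by
  unfold Jz Jv
  rw [← intervalIntegral.integral_const_mul, ← intervalIntegral.integral_const_mul]
  congr 1
  ext s
  ring

lemma J_rel2 {t : ℝ} (ht : t ∈ Set.Ioo (-1 : ℝ) 1) :
    (1 - (t : ℂ) ^ 2) * Jr x y t = Ju x y t + 2 * Jv x y t := by
  have c1 := Rk_cpow_contOn' hb hd (x / 2) ht
  have c2 := Rk_cpow_contOn' hb hd (x / 2 - 1) ht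
  unfold Jr Ju Jv
  rw [← intervalIntegral.integral_const_mul, ← intervalIntegral.integral_const_mul,
    ← intervalIntegral.integral_add (int_aux hb hd c1)]
  · apply intervalIntegral.integral_congr
    intro s hs
    rw [Set.uIcc_of_le zero_le_one] at hs
    have hR : ((Rk t s : ℝ) : ℂ) ≠ 0 := by exact_mod_cast (Rk_pos ht hs).ne'
    have : ((Rk t s : ℝ) : ℂ) ^ (x / 2) = ((Rk t s : ℝ) : ℂ) ^ (x / 2 - 1) * (Rk t s : ℝ) := by
      rw [cpow_sub _ _ hR, cpow_one]; field_simp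
    simp only [this]
    have e : ((Rk t s : ℝ) : ℂ) = (1 + (t : ℂ)) ^ 2 - 4 * t * s := by unfold Rk; push_cast; ring
    have e2 : ∀ q : ℂ, q * ((Rk t s : ℝ) : ℂ) = q * ((1 + (t : ℂ)) ^ 2 - 4 * t * s) := by
      intro q; rw [e]
    rw [e2]
    ring
  · apply IntervalIntegrable.const_mul
    apply int_aux hb hd
    fun_prop

lemma J_rel3 {t : ℝ} (ht : t ∈ Set.Ioo (-1 : ℝ) 1) :
    t * Jw x y t = x * Jv x y t + y * (t * Jr x y t) := by
  have c1 := Rk_cpow_contOn' hb hd (x / 2 - 1 - 1) ht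
  have c2 := Rk_cpow_contOn' hb hd (x / 2 - 1) ht
  set b : ℂ := (1 + y - x) / 2 with hbdef
  set d : ℂ := (1 - x - y) / 2 with hddef
  have key : t * Jw x y t - (x * Jv x y t + y * (t * Jr x y t)) = 
      ∫ s in (0 : ℝ)..1, Wt x y s * (t * ((2 * s - 1 - 2 * t) * ((Rk t s : ℝ) : ℂ) ^ (x / 2 - 1)
    + t * (2 * s - 1 - t) * ((x / 2 - 1) * ((Rk t s : ℝ) : ℂ) ^ (x / 2 - 1 - 1) * (2 * (1 + t) - 4 * s)))
      - x * (t * (2 * s - 1 - t) * ((Rk t s : ℝ) : ℂ) ^ (x / 2 - 1)) 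
      - y * t * ((Rk t s : ℝ) : ℂ) ^ (x / 2 - 1)) := by
    unfold Jw Jv Jr
    rw [← intervalIntegral.integral_const_mul, ← intervalIntegral.integral_const_mul,
      ← intervalIntegral.integral_const_mul, ← intervalIntegral.integral_const_mul,
      ← intervalIntegral.integral_add, ← intervalIntegral.integral_sub]
    · congr 1; ext s; ring
    · apply IntervalIntegrable.const_mul; apply int_aux hb hd; fun_prop
    · apply IntervalIntegrable.add
      · apply IntervalIntegrable.const_mul; apply int_aux hb hd; fun_prop
      · apply IntervalIntegrable.const_mul; apply IntervalIntegrable.const_mul; apply int_aux hb hd; fun_prop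
    · apply IntervalIntegrable.const_mul; apply int_aux hb hd; fun_prop
    · apply IntervalIntegrable.const_mul; apply IntervalIntegrable.const_mul; apply int_aux hb hd; fun_prop
  have hb0 : b ≠ 0 := by intro h; rw [h] at hb; simp at hb
  have hd0 : d ≠ 0 := by intro h; rw [h] at hd; simp at hd
  have ftc := intervalIntegral.integral_eq_sub_of_hasDerivAt_of_le (a := 0) (b := 1) zero_le_one
    (f := fun s : ℝ => (s : ℂ) ^ b * (1 - (s : ℂ)) ^ d * (-2 * t * ((Rk t s : ℝ) : ℂ) ^ (x / 2 - 1)))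
    (f' := fun s : ℝ => Wt x y s * (t * ((2 * s - 1 - 2 * t) * ((Rk t s : ℝ) : ℂ) ^ (x / 2 - 1)
    + t * (2 * s - 1 - t) * ((x / 2 - 1) * ((Rk t s : ℝ) : ℂ) ^ (x / 2 - 1 - 1) * (2 * (1 + t) - 4 * s)))
      - x * (t * (2 * s - 1 - t) * ((Rk t s : ℝ) : ℂ) ^ (x / 2 - 1)) 
      - y * t * ((Rk t s : ℝ) : ℂ) ^ (x / 2 - 1))) ?_ ?_ ?_
  · rw [← sub_eq_zero, key, ftc]
    simp [zero_cpow hb0, zero_cpow hd0]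
  · have h1 : Continuous (fun s : ℝ => (s : ℂ) ^ b) := by
      have := continuous_ofReal_cpow_const hb
      exact this
    have h2 : Continuous (fun s : ℝ => (1 - (s : ℂ)) ^ d) := by
      have := (continuous_ofReal_cpow_const hd).comp (continuous_sub_left (1 : ℝ))
      convert this using 2 with s
      simp
    fun_prop
  · intro s hs
    have hs' : s ∈ Set.Icc (0 : ℝ) 1 := ⟨hs.1.le, hs.2.le⟩
    have hsl : (s : ℂ) ∈ slitPlane := by rw [ofReal_mem_slitPlane]; exact hs.1
    have hsl2 : (1 - s : ℂ) ∈ slitPlane := by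
      have : (1 - s : ℂ) = ((1 - s : ℝ) : ℂ) := by push_cast; rfl
      rw [this, ofReal_mem_slitPlane]; linarith [hs.2]
    have h1 : HasDerivAt (fun s : ℝ => (s : ℂ) ^ b) (b * (s : ℂ) ^ (b - 1)) s := by
      have := ((hasDerivAt_id (s : ℂ)).cpow_const (c := b) hsl).comp_ofReal
      simpa using this
    have h2 : HasDerivAt (fun s : ℝ => (1 - (s : ℂ)) ^ d) (- (d * (1 - (s : ℂ)) ^ (d - 1))) s := by
      have := (((hasDerivAt_id (s : ℂ)).const_sub 1).cpow_const (c := d) hsl2).comp_ofReal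
      simpa using this
    have h3 := (Rk_hasDeriv_s (x / 2 - 1) ht hs').const_mul (-2 * (t : ℂ))
    have h4 := (h1.mul h2).mul h3
    refine h4.congr_deriv ?_
    unfold Wt
    rw [← hbdef, ← hddef]
    have hs0 : (s : ℂ) ≠ 0 := by exact_mod_cast hs.1.ne'
    have hs1 : (1 - s : ℂ) ≠ 0 := by
      have : (1 - s : ℝ) ≠ 0 := by linarith [hs.2]
      exact_mod_cast this
    have hR : ((Rk t s : ℝ) : ℂ) ≠ 0 := by exact_mod_cast (Rk_pos ht hs').ne'
    have e1 : (s : ℂ) ^ b = (s : ℂ) ^ (b - 1) * s := by rw [cpow_sub _ _ hs0, cpow_one]; field_simp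
    have e2 : (1 - s : ℂ) ^ d = (1 - s : ℂ) ^ (d - 1) * (1 - s) := by
      rw [cpow_sub _ _ hs1, cpow_one]; field_simp
    have e3 : ((Rk t s : ℝ) : ℂ) ^ (x / 2 - 1) = ((Rk t s : ℝ) : ℂ) ^ (x / 2 - 1 - 1) * (((1 + (t : ℂ)) ^ 2 - 4 * t * s)) := by
      have e : ((Rk t s : ℝ) : ℂ) = (1 + (t : ℂ)) ^ 2 - 4 * t * s := by unfold Rk; push_cast; ring
      rw [← e, cpow_sub (x / 2 - 1) 1 hR, cpow_one, div_mul_cancel₀ _ hR]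
    simp only [Pi.mul_apply]
    rw [e1, e2, e3]
    generalize (s : ℂ) ^ (b - 1) = A
    generalize (1 - s : ℂ) ^ (d - 1) = B
    generalize ((Rk t s : ℝ) : ℂ) ^ (x / 2 - 1 - 1) = D
    rw [hbdef, hddef]
    ring
  · apply int_aux hb hd; fun_prop

end

lemma uniq_aux {x y : ℂ} (hx : x.re ≤ 0) {p v p' v' : ℝ → ℂ}
    (hp : ∀ t ∈ Set.Ioo (-1 : ℝ) 1, HasDerivAt p (p' t) t)
    (hv : ∀ t ∈ Set.Ioo (-1 : ℝ) 1, HasDerivAt v (v' t) t)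
    (hp0 : p 0 = 0) (hv0 : v 0 = 0)
    (h1 : ∀ t ∈ Set.Ioo (0 : ℝ) 1, (t : ℂ) * (1 - (t : ℂ) ^ 2) * p' t = y * (t * (p t + v t)))
    (h2 : ∀ t ∈ Set.Ioo (0 : ℝ) 1,
      (t : ℂ) * (1 - (t : ℂ) ^ 2) * v' t = x * (1 - (t : ℂ) ^ 2) * v t + y * (t * (p t + v t)))
    {T : ℝ} (hT0 : 0 ≤ T) (hT : T < 1) : p T = 0 ∧ v T = 0 := by
  set C : ℝ := 4 * (‖y‖ / (1 - T ^ 2)) with hC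
  have hT2 : 0 < 1 - T ^ 2 := by nlinarith
  have hsub : Set.Icc 0 T ⊆ Set.Ioo (-1 : ℝ) 1 := fun u hu => ⟨by linarith [hu.1], by linarith [hu.2]⟩
  set E : ℝ → ℝ := fun t => (‖p t‖ ^ 2 + ‖v t‖ ^ 2) * Real.exp (-C * t) with hE
  have hder : ∀ t ∈ Set.Ioo (-1 : ℝ) 1, HasDerivAt E
      ((2 * inner ℝ (p t) (p' t) + 2 * inner ℝ (v t) (v' t)) * Real.exp (-C * t)
        + (‖p t‖ ^ 2 + ‖v t‖ ^ 2) * (Real.exp (-C * t) * (-C))) t := by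
    intro t ht
    have e1 := ((hp t ht).norm_sq).add ((hv t ht).norm_sq)
    have e2 : HasDerivAt (fun t : ℝ => Real.exp (-C * t)) (Real.exp (-C * t) * (-C)) t := by
      have := ((hasDerivAt_id t).const_mul (-C)).exp
      simpa using this
    exact e1.mul e2
  have hanti : AntitoneOn E (Set.Icc 0 T) := by
    apply antitoneOn_of_deriv_nonpos (convex_Icc 0 T)
    · intro t ht; exact (hder t (hsub ht)).continuousAt.continuousWithinAt
    · intro t ht
      exact (hder t (hsub (interior_subset ht))).differentiableAt.differentiableWithinAt
    · intro t ht
      rw [(hder t (hsub (interior_subset ht))).deriv]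
      rw [interior_Icc] at ht
      have ht0 : (0 : ℝ) < t := ht.1
      have ht1 : t < 1 := ht.2.trans hT
      have htm : t ∈ Set.Ioo (0 : ℝ) 1 := ⟨ht0, ht1⟩
      have ht2 : 0 < 1 - t ^ 2 := by nlinarith
      have ht2' : (1 - (t : ℂ) ^ 2) ≠ 0 := by exact_mod_cast ht2.ne'
      have ht0' : (t : ℂ) ≠ 0 := by exact_mod_cast ht0.ne'
      set Y : ℂ := y / (1 - (t : ℂ) ^ 2) with hY
      have hYn : ‖Y‖ ≤ ‖y‖ / (1 - T ^ 2) := by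
        rw [hY, norm_div]
        have : ‖(1 - (t : ℂ) ^ 2)‖ = 1 - t ^ 2 := by
          have e : (1 - (t : ℂ) ^ 2) = ((1 - t ^ 2 : ℝ) : ℂ) := by push_cast; rfl
          rw [e, Complex.norm_of_nonneg ht2.le]
        rw [this]
        apply div_le_div_of_nonneg_left (norm_nonneg _) hT2
        have := ht.2
        nlinarith
      have ep : p' t = Y * (p t + v t) := by
        have := h1 t htm
        rw [hY]; field_simp
        apply mul_left_cancel₀ ht0'
        linear_combination this
      have ev : v' t = ((x.re / t : ℝ) : ℂ) * v t + ((x.im / t : ℝ) : ℂ) * I * v t + Y * (p t + v t) := by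
        have := h2 t htm
        have hxx : x = x.re + x.im * I := (re_add_im x).symm
        have e : ((x.re / t : ℝ) : ℂ) * v t + ((x.im / t : ℝ) : ℂ) * I * v t = x / t * v t := by
          conv_rhs => rw [hxx]
          push_cast; ring
        rw [e, hY]
        field_simp
        linear_combination this
      have b1 : inner ℝ (p t) (p' t) ≤ ‖p t‖ * (‖Y‖ * (‖p t‖ + ‖v t‖)) := by
        refine (real_inner_le_norm _ _).trans ?_
        rw [ep, norm_mul]
        gcongr
        exact norm_add_le _ _
      have b2 : inner ℝ (v t) (v' t) ≤ ‖v t‖ * (‖Y‖ * (‖p t‖ + ‖v t‖)) := by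
        rw [ev, inner_add_right]
        have i1 : inner ℝ (v t) (((x.re / t : ℝ) : ℂ) * v t + ((x.im / t : ℝ) : ℂ) * I * v t) ≤ 0 := by
          have : inner ℝ (v t) (((x.re / t : ℝ) : ℂ) * v t + ((x.im / t : ℝ) : ℂ) * I * v t)
              = x.re / t * ((v t).re ^ 2 + (v t).im ^ 2) := by
            rw [Complex.inner]
            simp
            ring
          rw [this]
          apply mul_nonpos_of_nonpos_of_nonneg
          · exact div_nonpos_of_nonpos_of_nonneg hx ht0.le
          · positivity
        have i2 : inner ℝ (v t) (Y * (p t + v t)) ≤ ‖v t‖ * (‖Y‖ * (‖p t‖ + ‖v t‖)) := by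
          refine (real_inner_le_norm _ _).trans ?_
          rw [norm_mul]
          gcongr
          exact norm_add_le _ _
        linarith
      have b3 : 2 * inner ℝ (p t) (p' t) + 2 * inner ℝ (v t) (v' t) ≤ C * (‖p t‖ ^ 2 + ‖v t‖ ^ 2) := by
        have : ‖Y‖ * (‖p t‖ + ‖v t‖) ^ 2 ≤ (‖y‖ / (1 - T ^ 2)) * (2 * (‖p t‖ ^ 2 + ‖v t‖ ^ 2)) := by
          gcongr
          nlinarith [sq_nonneg (‖p t‖ - ‖v t‖)]
        rw [hC]
        nlinarith
      have := mul_le_mul_of_nonneg_right b3 (Real.exp_pos (-C * t)).le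
      nlinarith
  have := hanti (Set.left_mem_Icc.2 hT0) (Set.right_mem_Icc.2 hT0) hT0
  have h0 : E 0 = 0 := by simp [hE, hp0, hv0]
  rw [h0] at this
  have h3 : ‖p T‖ ^ 2 + ‖v T‖ ^ 2 ≤ 0 := by
    by_contra h
    push Not at h
    have := mul_pos h (Real.exp_pos (-C * T))
    simp only [hE] at *
    linarith
  constructor
  · have : ‖p T‖ ^ 2 = 0 := by nlinarith [sq_nonneg ‖p T‖, sq_nonneg ‖v T‖]
    simpa using this
  · have : ‖v T‖ ^ 2 = 0 := by nlinarith [sq_nonneg ‖p T‖, sq_nonneg ‖v T‖]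
    simpa using this


lemma Ju_zero {x y : ℂ} : Ju x y 0 = betaIntegral ((1 + y - x) / 2) ((1 - x - y) / 2) := by
  unfold Ju betaIntegral
  congr 1
  ext s
  simp [Wt, Rk]

lemma Jv_zero {x y : ℂ} : Jv x y 0 = 0 := by
  unfold Jv
  simp

lemma Ju_lim {x y : ℂ} (hx : x.re < 0) (hb : 0 < (((1 + y - x) / 2 : ℂ)).re)
    (hd : 0 < (((1 - x - y) / 2 : ℂ)).re) (he : 0 < (((1 - y) / 2 : ℂ)).re) :
    Tendsto (Ju x y) (nhdsWithin 1 (Set.Iio 1))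
      (nhds ((4 : ℂ) ^ (x / 2) * betaIntegral ((1 + y - x) / 2) ((1 - y) / 2))) := by
  have hne : ∀ᵐ s : ℝ ∂MeasureTheory.volume, s ≠ 1 := by
    simp [MeasureTheory.ae_iff]
  have hval : (4 : ℂ) ^ (x / 2) * betaIntegral ((1 + y - x) / 2) ((1 - y) / 2)
      = ∫ s in (0 : ℝ)..1, (4 : ℂ) ^ (x / 2) * ((s : ℂ) ^ ((1 + y - x) / 2 - 1) * (1 - (s : ℂ)) ^ ((1 - y) / 2 - 1)) := by
    rw [intervalIntegral.integral_const_mul]; rfl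
  have hcomb : ∀ s ∈ Set.Ioo (0 : ℝ) 1, Wt x y s * (((1 - s : ℝ)) : ℂ) ^ (x / 2)
      = (s : ℂ) ^ ((1 + y - x) / 2 - 1) * (1 - (s : ℂ)) ^ ((1 - y) / 2 - 1) := by
    intro s hs
    have hs1 : (1 - s : ℂ) ≠ 0 := by
      have : (1 - s : ℝ) ≠ 0 := by linarith [hs.2]
      exact_mod_cast this
    unfold Wt
    push_cast
    rw [mul_assoc, ← cpow_add _ _ hs1]
    congr 2
    ring
  rw [hval]
  apply intervalIntegral.tendsto_integral_filter_of_dominated_convergence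
    (bound := fun s : ℝ => ‖(s : ℂ) ^ ((1 + y - x) / 2 - 1) * (1 - (s : ℂ)) ^ ((1 - y) / 2 - 1)‖)
  · have : Set.Ioo (1/2 : ℝ) 1 ∈ nhdsWithin (1 : ℝ) (Set.Iio 1) := Ioo_mem_nhdsLT (by norm_num)
    filter_upwards [this] with t ht
    have ht' : t ∈ Set.Ioo (-1 : ℝ) 1 := ⟨by linarith [ht.1], ht.2⟩
    exact (int_aux hb hd (Rk_cpow_contOn' hb hd (x / 2) ht')).def'.aestronglyMeasurable
  · have : Set.Ioo (1/2 : ℝ) 1 ∈ nhdsWithin (1 : ℝ) (Set.Iio 1) := Ioo_mem_nhdsLT (by norm_num)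
    filter_upwards [this] with t ht
    filter_upwards [hne] with s hs hs'
    rw [Set.uIoc_of_le zero_le_one] at hs'
    have hs2 : s ∈ Set.Ioo (0 : ℝ) 1 := ⟨hs'.1, lt_of_le_of_ne hs'.2 hs⟩
    have hpos : 0 < 1 - s := by linarith [hs2.2]
    have hR : 1 - s ≤ Rk t s := by
      have : Rk t s = (1 - t) ^ 2 + 4 * t * (1 - s) := by unfold Rk; ring
      rw [this]
      nlinarith [ht.1, sq_nonneg (1 - t)]
    rw [← hcomb s hs2, norm_mul, norm_mul, norm_cpow_eq_rpow_re_of_pos (hpos.trans_le hR),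
      norm_cpow_eq_rpow_re_of_pos hpos]
    apply mul_le_mul_of_nonneg_left _ (norm_nonneg _)
    apply Real.rpow_le_rpow_of_nonpos hpos hR
    simp
    linarith
  · exact (betaIntegral_convergent hb he).norm
  · filter_upwards [hne] with s hs hs'
    rw [Set.uIoc_of_le zero_le_one] at hs'
    have hs2 : s ∈ Set.Ioo (0 : ℝ) 1 := ⟨hs'.1, lt_of_le_of_ne hs'.2 hs⟩
    have hpos : 0 < 1 - s := by linarith [hs2.2]
    have e : (4 : ℂ) ^ (x / 2) * ((s : ℂ) ^ ((1 + y - x) / 2 - 1) * (1 - (s : ℂ)) ^ ((1 - y) / 2 - 1))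
        = Wt x y s * ((Rk 1 s : ℝ) : ℂ) ^ (x / 2) := by
      rw [← hcomb s hs2]
      have : Rk 1 s = 4 * (1 - s) := by unfold Rk; ring
      rw [this, ofReal_mul, mul_cpow_ofReal_nonneg (by norm_num) hpos.le]
      push_cast; ring
    rw [e]
    apply Filter.Tendsto.const_mul
    apply tendsto_nhdsWithin_of_tendsto_nhds
    have hc : ContinuousAt (fun t : ℝ => ((Rk t s : ℝ) : ℂ) ^ (x / 2)) 1 := by
      refine ContinuousAt.cpow ?_ continuousAt_const ?_
      · unfold Rk; fun_prop
      · rw [ofReal_mem_slitPlane]; unfold Rk; linarith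
    exact hc

lemma gamma_final {x y : ℂ} (hb : 0 < (((1 + y - x) / 2 : ℂ)).re)
    (hd : 0 < (((1 - x - y) / 2 : ℂ)).re) (he : 0 < (((1 - y) / 2 : ℂ)).re) (hxr : x.re < 0)
    (hy : y.re < 1) :
    (4 : ℂ) ^ (x / 2) * betaIntegral ((1 + y - x) / 2) ((1 - y) / 2)
      / betaIntegral ((1 + y - x) / 2) ((1 - x - y) / 2) =
    Complex.Gamma (1 - x) * Complex.Gamma (1 - y) / Complex.Gamma (1 - x - y)
        * (Complex.Gamma (1 - (x + y) / 2)
            / (Complex.Gamma (1 - x / 2) * Complex.Gamma (1 - y / 2))) := by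
  rw [betaIntegral_eq_Gamma_mul_div _ _ hb he, betaIntegral_eq_Gamma_mul_div _ _ hb hd]
  have r1 : (1 + y - x) / 2 + (1 - y) / 2 = 1 - x / 2 := by ring
  have r2 : (1 + y - x) / 2 + (1 - x - y) / 2 = 1 - x := by ring
  rw [r1, r2]
  have d1 := Complex.Gamma_mul_Gamma_add_half ((1 - y) / 2)
  have d2 := Complex.Gamma_mul_Gamma_add_half ((1 - x - y) / 2)
  have s1 : (1 - y) / 2 + 1 / 2 = 1 - y / 2 := by ring
  have s2 : 2 * ((1 - y) / 2) = 1 - y := by ring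
  have s3 : (1 - x - y) / 2 + 1 / 2 = 1 - (x + y) / 2 := by ring
  have s4 : 2 * ((1 - x - y) / 2) = 1 - x - y := by ring
  rw [s1, s2] at d1
  rw [s3, s4] at d2
  have g1 := Gamma_ne_zero_of_re_pos hb
  have g2 := Gamma_ne_zero_of_re_pos hd
  have g3 := Gamma_ne_zero_of_re_pos he
  have g4 : Complex.Gamma (1 - x / 2) ≠ 0 := Gamma_ne_zero_of_re_pos (by simp; linarith)
  have g5 : Complex.Gamma (1 - y / 2) ≠ 0 := Gamma_ne_zero_of_re_pos (by simp; linarith)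
  have g6 : Complex.Gamma (1 - x) ≠ 0 := Gamma_ne_zero_of_re_pos (by simp; linarith)
  have g7 : Complex.Gamma (1 - x - y) ≠ 0 := by
    apply Gamma_ne_zero_of_re_pos
    rw [← s4]
    simpa using hd
  have hpi : ((√Real.pi : ℝ) : ℂ) ≠ 0 := by
    have := Real.sqrt_pos.2 Real.pi_pos
    exact_mod_cast this.ne'
  have hpow : (2 : ℂ) ^ (1 - (1 - x - y)) = (4 : ℂ) ^ (x / 2) * 2 ^ (1 - (1 - y)) := by
    have : (4 : ℂ) ^ (x / 2) = 2 ^ x := by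
      have : (4 : ℂ) = ((2 : ℝ) : ℂ) * ((2 : ℝ) : ℂ) := by push_cast; norm_num
      rw [this, mul_cpow_ofReal_nonneg (by norm_num) (by norm_num), ← cpow_add _ _ (by norm_num)]
      congr 1
      · ring
    rw [this, ← cpow_add _ _ two_ne_zero]
    congr 1; ring
  rw [hpow] at d2
  have hp2 : (2 : ℂ) ^ (1 - (1 - y)) ≠ 0 := by simp [cpow_eq_zero_iff]
  generalize (4 : ℂ) ^ (x / 2) = F at *
  generalize (2 : ℂ) ^ (1 - (1 - y)) = H at *
  generalize ((√Real.pi : ℝ) : ℂ) = q at *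
  generalize Complex.Gamma (1 - x / 2) = a1 at *
  generalize Complex.Gamma (1 - y / 2) = a2 at *
  generalize Complex.Gamma (1 - x) = a3 at *
  generalize Complex.Gamma (1 - y) = a4 at *
  generalize Complex.Gamma (1 - x - y) = a5 at *
  generalize Complex.Gamma ((1 - y) / 2) = a6 at *
  generalize Complex.Gamma ((1 - x - y) / 2) = a7 at *
  generalize Complex.Gamma (1 - (x + y) / 2) = a8 at *
  generalize Complex.Gamma ((1 + y - x) / 2) = a9 at *
  field_simp
  have : H * q ≠ 0 := mul_ne_zero hp2 hpi
  apply mul_left_cancel₀ this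
  linear_combination F * a5 * q * H * d1 - a4 * q * H * d2

def Pseq {R : Type*} [CommSemiring R] (w : ℕ → R) : ℕ → R
  | 0 => 0
  | 1 => 1
  | (n + 2) => Pseq w n + w (n + 1) * Pseq w (n + 1)

lemma Pseq_bound {w : ℕ → ℂ} (hw : ∀ m : ℕ, 1 ≤ m → ‖w m‖ ≤ 1 / m) : ∀ M : ℕ, ‖Pseq w M‖ ≤ M
  | 0 => by simp [Pseq]
  | 1 => by simp [Pseq]
  | (n + 2) => by
    have h1 := Pseq_bound hw n
    have h2 := Pseq_bound hw (n + 1)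
    have h3 := hw (n + 1) (by omega)
    rw [Pseq]
    refine (norm_add_le _ _).trans ?_
    rw [norm_mul]
    have : ‖w (n + 1)‖ * ‖Pseq w (n + 1)‖ ≤ 1 / ((n + 1 : ℕ) : ℝ) * ((n + 1 : ℕ) : ℝ) := by gcongr
    have h4 : (((n + 1 : ℕ)) : ℝ) ≠ 0 := by positivity
    rw [one_div, inv_mul_cancel₀ h4] at this
    push_cast at *
    linarith

lemma ser_summable {a : ℕ → ℂ} (ha : ∀ M : ℕ, ‖a M‖ ≤ M) {t : ℝ} (ht : t ∈ Set.Ioo (-1 : ℝ) 1) :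
    Summable (fun M => a M * (t : ℂ) ^ M) := by
  have hr : ‖t‖ < 1 := by rw [Real.norm_eq_abs, abs_lt]; exact ht
  have h := summable_norm_pow_mul_geometric_of_norm_lt_one (R := ℝ) 1 hr
  refine Summable.of_norm_bounded h fun M => ?_
  rw [norm_mul, norm_mul, norm_pow, norm_pow, norm_pow, Complex.norm_real]
  gcongr
  simpa using ha M

lemma ser_deriv {a : ℕ → ℂ} (ha : ∀ M : ℕ, ‖a M‖ ≤ M) {t : ℝ} (ht : t ∈ Set.Ioo (-1 : ℝ) 1) :
    HasDerivAt (fun t : ℝ => ∑' M, a M * (t : ℂ) ^ M) (∑' M, a M * (M * (t : ℂ) ^ (M - 1))) t := by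
  have hr : |t| < 1 := by rw [abs_lt]; exact ht
  obtain ⟨r, hr1, hr2⟩ := exists_between hr
  have hr0 : 0 < r := (abs_nonneg t).trans_lt hr1
  have h := summable_norm_pow_mul_geometric_of_norm_lt_one (R := ℝ) (r := r) 2
    (by rwa [Real.norm_eq_abs, abs_of_pos hr0])
  refine hasDerivAt_tsum_of_isPreconnected (t := Set.Ioo (-r) r) (y₀ := 0)
    (g := fun M (t : ℝ) => a M * (t : ℂ) ^ M) (g' := fun M (t : ℝ) => a M * (M * (t : ℂ) ^ (M - 1)))
    (h.mul_right r⁻¹) isOpen_Ioo isPreconnected_Ioo ?_ ?_ ?_ ?_ ?_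
  · intro M u hu
    have h0 : HasDerivAt (fun t : ℝ => (t : ℂ)) 1 u := Complex.ofRealCLM.hasDerivAt
    have := (h0.pow M).const_mul (a M)
    exact this.congr_deriv (by ring)
  · intro M u hu
    rcases M with _ | M
    · simp
    · have hu' : |u| ≤ r := abs_le.2 ⟨hu.1.le, hu.2.le⟩
      rw [norm_mul, norm_mul, norm_mul, norm_pow, norm_pow, norm_pow, Complex.norm_real]
      simp only [Real.norm_eq_abs, Complex.norm_natCast, abs_of_pos hr0]
      have : |((M + 1 : ℕ) : ℝ)| = ((M + 1 : ℕ) : ℝ) := abs_of_nonneg (by positivity)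
      rw [this]
      have e : ((M + 1 : ℕ) : ℝ) ^ 2 * r ^ (M + 1) * r⁻¹ = ((M + 1 : ℕ) : ℝ) * (((M + 1 : ℕ) : ℝ) * r ^ M) := by
        field_simp
        try ring
      rw [e]
      gcongr
      · exact ha _
      · simp
        gcongr
  · exact ⟨by linarith, hr0⟩
  · apply ser_summable ha; constructor <;> norm_num
  · exact ⟨by linarith [neg_abs_le t], by linarith [le_abs_self t]⟩

lemma natsub_norm {x : ℂ} (hx : x.re < 0) (M : ℕ) : (M : ℝ) ≤ ‖(M : ℂ) - x‖ := by
  refine le_trans ?_ (Complex.re_le_norm _)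
  simp; linarith

lemma natsub_ne {x : ℂ} (hx : x.re < 0) (M : ℕ) : (M : ℂ) - x ≠ 0 := by
  intro h
  have := congrArg Complex.re h
  simp at this
  have : (0 : ℝ) ≤ M := Nat.cast_nonneg M
  linarith

def wC (x y : ℂ) (m : ℕ) : ℂ := y * (1 / m + 1 / (m - x))

lemma wC_bound {x y : ℂ} (hx : x.re < 0) (hy : ‖y‖ < 1 / 4) (m : ℕ) (hm : 1 ≤ m) :
    ‖wC x y m‖ ≤ 1 / m := by
  have hm' : (0 : ℝ) < m := by exact_mod_cast hm
  unfold wC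
  rw [norm_mul]
  have h1 : ‖(1 / m + 1 / (m - x) : ℂ)‖ ≤ 1 / m + 1 / m := by
    refine (norm_add_le _ _).trans ?_
    rw [norm_div, norm_div, norm_one, Complex.norm_natCast]
    gcongr
    exact natsub_norm hx m
  have h2 : (0 : ℝ) < 1 / m := by positivity
  nlinarith [norm_nonneg y, norm_nonneg (1 / m + 1 / (m - x) : ℂ)]

lemma u_eq {x y : ℂ} (hx : x.re < 0) (hy : ‖y‖ < 1 / 4)
    (hb : 0 < (((1 + y - x) / 2 : ℂ)).re) (hd : 0 < (((1 - x - y) / 2 : ℂ)).re)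
    {t : ℝ} (ht0 : 0 ≤ t) (ht : t < 1) :
    1 - x * y / 2 * ∑' M : ℕ, Pseq (wC x y) M * (2 / (M * (M - x))) * (t : ℂ) ^ M
      = Ju x y t / betaIntegral ((1 + y - x) / 2) ((1 - x - y) / 2) := by
  set B := betaIntegral ((1 + y - x) / 2) ((1 - x - y) / 2) with hB
  have hB0 : B ≠ 0 := by
    rw [hB, betaIntegral_eq_Gamma_mul_div _ _ hb hd]
    have g1 := Gamma_ne_zero_of_re_pos hb
    have g2 := Gamma_ne_zero_of_re_pos hd
    have g3 : Complex.Gamma ((1 + y - x) / 2 + (1 - x - y) / 2) ≠ 0 :=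
      Gamma_ne_zero_of_re_pos (by rw [add_re]; linarith)
    exact div_ne_zero (mul_ne_zero g1 g2) g3
  set P := Pseq (wC x y) with hP
  have hP0 : P 0 = 0 := rfl
  have hPb : ∀ M : ℕ, ‖P M‖ ≤ M := Pseq_bound (wC_bound hx hy)
  set a : ℕ → ℂ := fun M => y / M * P M with ha
  set c : ℕ → ℂ := fun M => y / (M - x) * P M with hc
  have hab : ∀ M : ℕ, ‖a M‖ ≤ M := by
    intro M
    rcases Nat.eq_zero_or_pos M with h | h
    · subst h; simp [ha]
    · have h' : (1 : ℝ) ≤ M := by exact_mod_cast h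
      simp only [ha]
      rw [norm_mul, norm_div, Complex.norm_natCast]
      have : ‖y‖ / M * ‖P M‖ ≤ 1 / 1 * M := by
        gcongr
        · linarith
        · exact hPb M
      linarith
  have hcb : ∀ M : ℕ, ‖c M‖ ≤ M := by
    intro M
    rcases Nat.eq_zero_or_pos M with h | h
    · subst h; simp [hc, hP0]
    · have h' : (1 : ℝ) ≤ M := by exact_mod_cast h
      simp only [hc]
      rw [norm_mul, norm_div]
      have : ‖y‖ / ‖(M : ℂ) - x‖ * ‖P M‖ ≤ 1 / 1 * M := by
        gcongr
        · linarith
        · exact h'.trans (natsub_norm hx M)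
        · exact hPb M
      linarith
  set p : ℝ → ℂ := fun t => 1 + ∑' M, a M * (t : ℂ) ^ M with hp
  set v : ℝ → ℂ := fun t => ∑' M, c M * (t : ℂ) ^ M with hv
  set f : ℝ → ℂ := fun t => ∑' M, P M * (t : ℂ) ^ M with hf
  set p' : ℝ → ℂ := fun t => ∑' M, a M * (M * (t : ℂ) ^ (M - 1)) with hp'
  set v' : ℝ → ℂ := fun t => ∑' M, c M * (M * (t : ℂ) ^ (M - 1)) with hv'
  have hpd : ∀ t ∈ Set.Ioo (-1 : ℝ) 1, HasDerivAt p (p' t) t := fun t ht => (ser_deriv hab ht).const_add 1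
  have hvd : ∀ t ∈ Set.Ioo (-1 : ℝ) 1, HasDerivAt v (v' t) t := fun t ht => ser_deriv hcb ht
  have r1 : ∀ t ∈ Set.Ioo (-1 : ℝ) 1, t * p' t = y * f t := by
    intro t ht
    simp only [hp', hf]
    rw [← tsum_mul_left, ← tsum_mul_left]
    congr 1; ext M
    rcases M with _ | M
    · simp [hP0]
    · simp only [ha]
      have : ((M + 1 : ℕ) : ℂ) ≠ 0 := by exact_mod_cast (Nat.succ_ne_zero M)
      simp only [Nat.add_sub_cancel]
      field_simp
      ring
  have r2 : ∀ t ∈ Set.Ioo (-1 : ℝ) 1, t * v' t = x * v t + y * f t := by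
    intro t ht
    simp only [hv', hf, hv]
    rw [← tsum_mul_left, ← tsum_mul_left, ← tsum_mul_left, ← Summable.tsum_add
      ((ser_summable hcb ht).mul_left x) ((ser_summable hPb ht).mul_left y)]
    congr 1; ext M
    rcases M with _ | M
    · simp [hP0, hc]
    · simp only [hc]
      have := natsub_ne hx (M + 1)
      simp only [Nat.add_sub_cancel]
      field_simp
      ring
  have r3 : ∀ t ∈ Set.Ioo (-1 : ℝ) 1, (1 - (t : ℂ) ^ 2) * f t = t * (p t + v t) := by
    intro t ht
    have s1 := ser_summable hPb ht
    have e1 : f t = t + ∑' M, P (M + 2) * (t : ℂ) ^ (M + 2) := by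
      have := s1.sum_add_tsum_nat_add 2
      simp only [hf]
      rw [← this]
      simp [Finset.sum_range_succ, hP0]
      rw [hP]; simp [Pseq]
    have s2 : Summable (fun M => (a M + c M) * (t : ℂ) ^ M) := by
      simp_rw [add_mul]
      exact (ser_summable hab ht).add (ser_summable hcb ht)
    have e2 : p t + v t = 1 + ∑' M, (a M + c M) * (t : ℂ) ^ M := by
      simp_rw [add_mul]
      rw [(ser_summable hab ht).tsum_add (ser_summable hcb ht)]
      simp only [hp, hv]; ring
    have e3 : ∑' M, (a M + c M) * (t : ℂ) ^ M = ∑' M, (a (M + 1) + c (M + 1)) * (t : ℂ) ^ (M + 1) := by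
      have := s2.sum_add_tsum_nat_add 1
      rw [← this]
      simp [hP0, ha, hc]
    have s3 : Summable (fun M => (a (M + 1) + c (M + 1)) * (t : ℂ) ^ (M + 1)) :=
      (summable_nat_add_iff 1).2 s2
    have e4 : ∑' M, P (M + 2) * (t : ℂ) ^ (M + 2)
        = (t : ℂ) ^ 2 * f t + t * ∑' M, (a (M + 1) + c (M + 1)) * (t : ℂ) ^ (M + 1) := by
      simp only [hf]
      rw [← tsum_mul_left, ← tsum_mul_left, ← (s1.mul_left _).tsum_add (s3.mul_left _)]
      congr 1; ext M
      have : P (M + 2) = P M + wC x y (M + 1) * P (M + 1) := rfl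
      rw [this]
      simp only [ha, hc, wC]
      ring
    rw [e2, e3]
    linear_combination e1 + e4
  -- compare
  have hm : ∀ t ∈ Set.Ioo (0 : ℝ) 1, t ∈ Set.Ioo (-1 : ℝ) 1 := fun t ht => ⟨by linarith [ht.1], ht.2⟩
  have huniq := uniq_aux (x := x) (y := y) hx.le
    (p := fun t => p t - (Ju x y t + Jv x y t) / B) (v := fun t => v t - Jv x y t / B)
    (p' := fun t => p' t - (Jz x y t + Jw x y t) / B) (v' := fun t => v' t - Jw x y t / B)
    (fun t ht => (hpd t ht).sub (((Ju_deriv hb hd ht).add (Jv_deriv hb hd ht)).div_const B))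
    (fun t ht => (hvd t ht).sub ((Jv_deriv hb hd ht).div_const B))
    ?_ ?_ ?_ ?_ ht0 ht
  · have hpv : p t - v t = Ju x y t / B := by
      have h1 := huniq.1
      have h2 := huniq.2
      linear_combination h1 - h2
    rw [← hpv]
    have htm : t ∈ Set.Ioo (-1 : ℝ) 1 := ⟨by linarith, ht⟩
    simp only [hp, hv]
    rw [add_sub_assoc, ← (ser_summable hab htm).tsum_sub (ser_summable hcb htm), ← tsum_mul_left, sub_eq_add_neg,
      ← tsum_neg]
    congr 2; ext M
    rcases M with _ | M
    · simp [hP0, ha, hc]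
    · simp only [hc, ha]
      have := natsub_ne hx (M + 1)
      have : ((M + 1 : ℕ) : ℂ) ≠ 0 := by exact_mod_cast (Nat.succ_ne_zero M)
      field_simp
      ring
  · have h0 : p 0 = 1 := by
      have : ∀ M, a M * ((0 : ℝ) : ℂ) ^ M = 0 := by
        intro M
        rcases M with _ | M
        · simp [hP0, ha]
        · simp
      simp only [hp]
      simp_rw [this]
      simp
    simp only [h0, Ju_zero, Jv_zero, ← hB]
    field_simp
    ring
  · have h0 : v 0 = 0 := by
      have : ∀ M, c M * ((0 : ℝ) : ℂ) ^ M = 0 := by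
        intro M
        rcases M with _ | M
        · simp [hP0, hc]
        · simp
      simp only [hv]
      simp_rw [this]
      simp
    simp [h0, Jv_zero]
  · intro t ht
    have h1 := r1 t (hm t ht)
    have h3 := r3 t (hm t ht)
    have j1 := J_rel1 hb hd (hm t ht)
    have j2 := J_rel2 hb hd (hm t ht)
    have j3 := J_rel3 hb hd (hm t ht)
    field_simp
    linear_combination B * (1 - (t : ℂ) ^ 2) * h1 + B * y * h3 - (1 - (t : ℂ) ^ 2) * j1 - (1 - (t : ℂ) ^ 2) * j3 - y * t * j2
  · intro t ht
    have h2 := r2 t (hm t ht)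
    have h3 := r3 t (hm t ht)
    have j2 := J_rel2 hb hd (hm t ht)
    have j3 := J_rel3 hb hd (hm t ht)
    field_simp
    linear_combination B * (1 - (t : ℂ) ^ 2) * h2 + B * y * h3 - (1 - (t : ℂ) ^ 2) * j3 - y * t * j2

def Qs {R : Type*} [CommSemiring R] (w : ℕ → R) : ℕ → ℕ → R
  | 0, M => if M % 2 = 1 then 1 else 0
  | (n + 1), M => if M % 2 = n % 2 then ∑ m ∈ Finset.range M, w m * Qs w n m else 0

lemma Qs_par {R : Type*} [CommSemiring R] (w : ℕ → R) (n M : ℕ) (h : M % 2 ≠ (n + 1) % 2) :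
    Qs w n M = 0 := by
  cases n with
  | zero => rw [Qs, if_neg]; omega
  | succ n => rw [Qs, if_neg]; omega

lemma Qs_zero {R : Type*} [CommSemiring R] (w : ℕ → R) (n M : ℕ) (h : M ≤ n) : Qs w n M = 0 := by
  induction n generalizing M with
  | zero => rw [Qs, if_neg]; omega
  | succ n ih =>
    rw [Qs]
    split_ifs
    · apply Finset.sum_eq_zero
      intro m hm
      rw [ih m (by have := Finset.mem_range.1 hm; omega), mul_zero]
    · rfl

lemma Qs_rec {R : Type*} [CommSemiring R] (w : ℕ → R) (n M : ℕ) :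
    Qs w (n + 1) (M + 2) = Qs w (n + 1) M + w (M + 1) * Qs w n (M + 1) := by
  by_cases h : M % 2 = n % 2
  · rw [Qs, Qs, if_pos h, if_pos (by omega), Finset.sum_range_succ, Finset.sum_range_succ,
      Qs_par w n M (by omega), mul_zero, add_zero]
  · rw [Qs, Qs, if_neg h, if_neg (by omega), Qs_par w n (M + 1) (by omega)]; simp

lemma Pseq_eq {R : Type*} [CommSemiring R] (w : ℕ → R) : ∀ (M N : ℕ), M ≤ N →
    ∑ n ∈ Finset.range N, Qs w n M = Pseq w M
  | 0, N, h => by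
    rw [Pseq]
    exact Finset.sum_eq_zero fun n _ => Qs_zero w n 0 (Nat.zero_le _)
  | 1, N, h => by
    obtain ⟨N, rfl⟩ : ∃ N', N = N' + 1 := ⟨N - 1, by omega⟩
    rw [Finset.sum_range_succ', Finset.sum_eq_zero fun n _ => Qs_zero w (n + 1) 1 (by omega)]
    simp [Qs, Pseq]
  | (M + 2), N, h => by
    obtain ⟨N, rfl⟩ : ∃ N', N = N' + 1 := ⟨N - 1, by omega⟩
    have h1 := Pseq_eq w M (N + 1) (by omega)
    have h2 := Pseq_eq w (M + 1) N (by omega)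
    rw [Finset.sum_range_succ'] at h1 ⊢
    simp_rw [Qs_rec]
    rw [Finset.sum_add_distrib, ← Finset.mul_sum, h2, Pseq, ← h1]
    have : Qs w 0 (M + 2) = Qs w 0 M := by simp [Qs]
    rw [this]
    ring

def cnd (n M : ℕ) (m : Fin n → ℕ) : Prop :=
  athCond n m ∧ (∀ i, m i < M) ∧ M % 2 = (n + 1) % 2

lemma ath_snoc (n a : ℕ) (m : Fin n → ℕ) :
    athCond (n + 1) (Fin.snoc (α := fun _ => ℕ) m a) ↔ cnd n a m := by
  unfold athCond cnd athCond
  constructor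
  · rintro ⟨h1, h2⟩
    refine ⟨⟨?_, ?_⟩, ?_, ?_⟩
    · intro i j hij
      have := h1 (Fin.castSucc_lt_castSucc_iff.2 hij)
      simpa using this
    · intro i
      have := h2 i.castSucc
      simpa using this
    · intro i
      have := h1 (Fin.castSucc_lt_last i)
      simpa using this
    · have := (h2 (Fin.last n)).1
      simpa using this
  · rintro ⟨⟨h1, h2⟩, h3, h4⟩
    refine ⟨?_, ?_⟩
    · intro i j
      induction j using Fin.lastCases with
      | last =>
        induction i using Fin.lastCases with
        | last => simp
        | cast i => intro _; simpa using h3 i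
      | cast j =>
        induction i using Fin.lastCases with
        | last => intro h; exact absurd h (not_lt.2 (Fin.le_last _))
        | cast i => intro h; simpa using h1 (Fin.castSucc_lt_castSucc_iff.1 h)
    · intro i
      induction i using Fin.lastCases with
      | last =>
        simp only [Fin.snoc_last, Fin.val_last]
        refine ⟨h4, ?_⟩
        rcases n with _ | n
        · omega
        · exact (Nat.zero_le _).trans_lt (h3 0)
      | cast i => simpa using h2 i

lemma cnd_snoc (n M a : ℕ) (m : Fin n → ℕ) :
    cnd (n + 1) M (Fin.snoc (α := fun _ => ℕ) m a) ↔ (a < M ∧ M % 2 = n % 2) ∧ cnd n a m := by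
  rw [cnd, ath_snoc]
  constructor
  · rintro ⟨h1, h2, h3⟩
    refine ⟨⟨?_, by omega⟩, h1⟩
    simpa using h2 (Fin.last n)
  · rintro ⟨⟨h1, h2⟩, h3⟩
    refine ⟨h3, ?_, by omega⟩
    intro i
    induction i using Fin.lastCases with
    | last => simpa using h1
    | cast i =>
      have := h3.2.1 i
      simp; omega

def Vv {R : Type*} [CommSemiring R] (g : ℕ × ℕ → R) (n M : ℕ) (c : Fin n → ℕ × ℕ) : R :=
  if cnd n M (fun i => (c i).1) then ∏ i, g (c i) else 0

lemma snoc_fst {n : ℕ} (c : Fin n → ℕ × ℕ) (a : ℕ × ℕ) :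
    (fun i => (Fin.snoc (α := fun _ => ℕ × ℕ) c a i).1)
      = Fin.snoc (α := fun _ => ℕ) (fun i => (c i).1) a.1 := by
  ext i
  induction i using Fin.lastCases with
  | last => simp
  | cast i => simp

lemma Vv_snoc {R : Type*} [CommSemiring R] (g : ℕ × ℕ → R) (n M : ℕ) (c : Fin n → ℕ × ℕ) (a : ℕ × ℕ) :
    Vv g (n + 1) M (Fin.snoc (α := fun _ => ℕ × ℕ) c a)
      = (if a.1 < M ∧ M % 2 = n % 2 then g a else 0) * Vv g n a.1 c := by
  unfold Vv
  rw [snoc_fst, cnd_snoc, Fin.prod_univ_castSucc]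
  simp only [Fin.snoc_castSucc, Fin.snoc_last]
  by_cases h1 : a.1 < M ∧ M % 2 = n % 2
  · by_cases h2 : cnd n a.1 (fun i => (c i).1)
    · rw [if_pos ⟨h1, h2⟩, if_pos h1, if_pos h2, mul_comm]
    · rw [if_neg (fun h => h2 h.2), if_neg h2, mul_zero]
  · rw [if_neg (fun h => h1 h.1), if_neg h1, zero_mul]

lemma Vv_zero {R : Type*} [CommSemiring R] (g : ℕ × ℕ → R) (w : ℕ → R) (M : ℕ) (c : Fin 0 → ℕ × ℕ) :
    Vv g 0 M c = Qs w 0 M := by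
  unfold Vv Qs cnd athCond
  simp [Subsingleton.strictMono]

lemma Vv_tsum_enn (g : ℕ × ℕ → ENNReal) (n M : ℕ) :
    ∑' c, Vv g n M c = Qs (fun m => ∑' k, g (m, k)) n M := by
  induction n generalizing M with
  | zero => simp [Vv_zero g (fun m => ∑' k, g (m, k))]
  | succ n ih =>
    rw [← (Fin.snocEquiv (fun _ => ℕ × ℕ)).tsum_eq, ENNReal.tsum_prod', ENNReal.tsum_prod']
    have : ∀ m k, ∑' c, Vv g (n + 1) M ((Fin.snocEquiv (fun _ => ℕ × ℕ)) ((m, k), c))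
        = (if m < M ∧ M % 2 = n % 2 then Qs (fun m => ∑' k, g (m, k)) n m else 0) * g (m, k) := by
      intro m k
      have : ∀ c, Vv g (n + 1) M ((Fin.snocEquiv (fun _ => ℕ × ℕ)) ((m, k), c)) = _ :=
        fun c => Vv_snoc g n M c (m, k)
      simp_rw [this]
      rw [ENNReal.tsum_mul_left, ih]
      split_ifs
      · rw [mul_comm]
      · simp
    simp_rw [this, ENNReal.tsum_mul_left]
    rw [Qs]
    split_ifs with h
    · rw [tsum_eq_sum (s := Finset.range M)]
      · apply Finset.sum_congr rfl
        intro m hm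
        rw [if_pos ⟨Finset.mem_range.1 hm, h⟩, mul_comm]
      · intro m hm
        rw [if_neg (fun h => hm (Finset.mem_range.2 h.1)), zero_mul]
    · simp [h]

lemma Vv_tsum_C (g : ℕ × ℕ → ℂ) (hs : ∀ n M, Summable (Vv g n M)) (n M : ℕ) :
    ∑' c, Vv g n M c = Qs (fun m => ∑' k, g (m, k)) n M := by
  induction n generalizing M with
  | zero => simp [Vv_zero g (fun m => ∑' k, g (m, k))]
  | succ n ih =>
    have hs1 := (Fin.snocEquiv (fun _ => ℕ × ℕ)).summable_iff.2 (hs (n + 1) M)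
    have : ∀ m k, ∑' c, Vv g (n + 1) M ((Fin.snocEquiv (fun _ => ℕ × ℕ)) ((m, k), c))
        = (if m < M ∧ M % 2 = n % 2 then Qs (fun m => ∑' k, g (m, k)) n m else 0) * g (m, k) := by
      intro m k
      have : ∀ c, Vv g (n + 1) M ((Fin.snocEquiv (fun _ => ℕ × ℕ)) ((m, k), c)) = _ :=
        fun c => Vv_snoc g n M c (m, k)
      simp_rw [this]
      rw [tsum_mul_left, ih]
      split_ifs
      · rw [mul_comm]
      · simp
    rw [← (Fin.snocEquiv (fun _ => ℕ × ℕ)).tsum_eq]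
    have e1 := hs1.tsum_prod
    have e2 := hs1.prod.tsum_prod
    simp only [Function.comp_def] at e1 e2
    rw [e1, e2]
    simp_rw [this, tsum_mul_left]
    rw [Qs]
    split_ifs with h
    · rw [tsum_eq_sum (s := Finset.range M)]
      · apply Finset.sum_congr rfl
        intro m hm
        rw [if_pos ⟨Finset.mem_range.1 hm, h⟩, mul_comm]
      · intro m hm
        rw [if_neg (fun h => hm (Finset.mem_range.2 h.1)), zero_mul]
    · simp [h]

lemma Vv_enorm (g : ℕ × ℕ → ℂ) (n M : ℕ) (c : Fin n → ℕ × ℕ) :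
    ‖Vv g n M c‖ₑ = Vv (fun a => ‖g a‖ₑ) n M c := by
  unfold Vv
  split_ifs
  · simp [← ofReal_norm, norm_prod, ENNReal.ofReal_prod_of_nonneg]
  · simp

lemma summable_of_enorm_ne_top {ι : Type*} {f : ι → ℂ} (h : ∑' i, ‖f i‖ₑ ≠ ⊤) : Summable f := by
  apply Summable.of_norm
  have := ENNReal.summable_toReal h
  simpa using this

lemma total_sum (g h : ℕ × ℕ → ℂ) 
    (hfin : ∑' m, (∑' k, ‖h (m, k)‖ₑ) * Pseq (fun m => ∑' k, ‖g (m, k)‖ₑ) m ≠ ⊤)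
    (hfin2 : ∀ m, Pseq (fun m => ∑' k, ‖g (m, k)‖ₑ) m ≠ ⊤) :
    Summable (fun b : (ℕ × ℕ) × (Σ n : ℕ, Fin n → ℕ × ℕ) => h b.1 * Vv g b.2.1 b.1.1 b.2.2) ∧
    ∑' b : (ℕ × ℕ) × (Σ n : ℕ, Fin n → ℕ × ℕ), h b.1 * Vv g b.2.1 b.1.1 b.2.2
      = ∑' m, (∑' k, h (m, k)) * Pseq (fun m => ∑' k, g (m, k)) m := by
  have hen : ∀ M, ∑' q : (Σ n : ℕ, Fin n → ℕ × ℕ), ‖Vv g q.1 M q.2‖ₑ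
      = Pseq (fun m => ∑' k, ‖g (m, k)‖ₑ) M := by
    intro M
    rw [ENNReal.tsum_sigma']
    simp_rw [Vv_enorm, Vv_tsum_enn]
    rw [tsum_eq_sum (s := Finset.range M), Pseq_eq _ M M le_rfl]
    intro n hn
    apply Qs_zero
    simpa using hn
  have hs : ∀ M, Summable (fun q : (Σ n : ℕ, Fin n → ℕ × ℕ) => Vv g q.1 M q.2) := by
    intro M
    apply summable_of_enorm_ne_top
    rw [hen]; exact hfin2 M
  have hS : Summable (fun b : (ℕ × ℕ) × (Σ n : ℕ, Fin n → ℕ × ℕ) => h b.1 * Vv g b.2.1 b.1.1 b.2.2) := by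
    apply summable_of_enorm_ne_top
    rw [ENNReal.tsum_prod', ENNReal.tsum_prod']
    simp_rw [enorm_mul, ENNReal.tsum_mul_left, hen, ENNReal.tsum_mul_right]
    exact hfin
  refine ⟨hS, ?_⟩
  have hv : ∀ M, ∑' q : (Σ n : ℕ, Fin n → ℕ × ℕ), Vv g q.1 M q.2 = Pseq (fun m => ∑' k, g (m, k)) M := by
    intro M
    rw [(hs M).tsum_sigma]
    have : ∀ n, ∑' c, Vv g n M c = Qs (fun m => ∑' k, g (m, k)) n M :=
      fun n => Vv_tsum_C g (fun n M => (hs M).sigma_factor n) n M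
    simp_rw [this]
    rw [tsum_eq_sum (s := Finset.range M), Pseq_eq _ M M le_rfl]
    intro n hn
    apply Qs_zero
    simpa using hn
  rw [hS.tsum_prod, hS.prod.tsum_prod]
  simp_rw [tsum_mul_left, hv, tsum_mul_right]

abbrev BigS := Σ p : ℕ × ℕ × ℕ, (Fin p.2.1 → ℕ) × (Fin p.2.1 → ℕ)

def HH (x y z t : ℂ) (q : BigS) : ℂ :=
  if (1 ≤ q.1.1 ∧ 1 ≤ q.1.2.1 ∧ 1 ≤ q.1.2.2) ∧ IdxCond0 q.1.1 q.1.2.1 q.1.2.2 q.2.1 ∧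
      athCond q.1.2.1 q.2.2 then
    2 ^ q.1.2.1 * (t ^ lastExp q.2.2 / ∏ i, ((q.2.2 i : ℂ) ^ q.2.1 i))
      * x ^ (q.1.1 - q.1.2.1 - q.1.2.2) * y ^ (q.1.2.1 - q.1.2.2) * z ^ (2 * (q.1.2.2 - 1))
  else 0

lemma Phi0Term_eq (x y z t : ℂ) (p : ℕ × ℕ × ℕ) :
    Phi0Term x y z p t = ∑' κ : Fin p.2.1 → ℕ, ∑' m : Fin p.2.1 → ℕ, HH x y z t ⟨p, (κ, m)⟩ := by
  unfold Phi0Term HH G0 Ath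
  by_cases hp : 1 ≤ p.1 ∧ 1 ≤ p.2.1 ∧ 1 ≤ p.2.2
  · rw [if_pos hp, ← tsum_mul_left, ← tsum_mul_right, ← tsum_mul_right, ← tsum_mul_right]
    congr 1
    ext κ
    by_cases hk : IdxCond0 p.1 p.2.1 p.2.2 κ
    · rw [if_pos hk, ← tsum_mul_left, ← tsum_mul_right, ← tsum_mul_right, ← tsum_mul_right]
      congr 1
      ext m
      by_cases hm : athCond p.2.1 m
      · rw [if_pos hm, if_pos ⟨hp, hk, hm⟩]
      · rw [if_neg hm, if_neg (fun h => hm h.2.2)]; simp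
    · rw [if_neg hk]
      simp [hk]
  · rw [if_neg hp]
    simp [hp]

lemma Phi0_eq_s15 (x y z t : ℂ) (hs : Summable (HH x y z t)) :
    Phi0 x y z t = ∑' q, HH x y z t q := by
  rw [Phi0, hs.tsum_sigma]
  congr 1
  ext p
  rw [Phi0Term_eq, (hs.sigma_factor p).tsum_prod]

def mkS {n : ℕ} (κ m : Fin n → ℕ) : BigS :=
  ⟨(∑ i, κ i, n, (Finset.univ.filter fun i => 2 ≤ κ i).card), (κ, m)⟩

def iS (b : (ℕ × ℕ) × (Σ n : ℕ, Fin n → ℕ × ℕ)) : BigS :=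
  mkS (n := b.2.1 + 1) (Fin.snoc (α := fun _ => ℕ) (fun i => (b.2.2 i).2) b.1.2)
    (Fin.snoc (α := fun _ => ℕ) (fun i => (b.2.2 i).1) b.1.1)

def jS : BigS → (ℕ × ℕ) × (Σ n : ℕ, Fin n → ℕ × ℕ)
  | ⟨(_, 0, _), _⟩ => ((0, 0), ⟨0, fun _ => (0, 0)⟩)
  | ⟨(_, n + 1, _), (κ, m)⟩ =>
    ((m (Fin.last n), κ (Fin.last n)), ⟨n, fun i => (m i.castSucc, κ i.castSucc)⟩)

lemma jS_iS (b) : jS (iS b) = b := by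
  obtain ⟨⟨m, k⟩, ⟨n, c⟩⟩ := b
  simp [iS, jS, mkS]

lemma iS_inj : Function.Injective iS := Function.LeftInverse.injective jS_iS

lemma HH_support (x y z t : ℂ) : Function.support (HH x y z t) ⊆ Set.range iS := by
  rintro ⟨⟨k, n, s⟩, ⟨κ, m⟩⟩ hq
  have hc : (1 ≤ k ∧ 1 ≤ n ∧ 1 ≤ s) ∧ IdxCond0 k n s κ ∧ athCond n m := by
    by_contra h
    exact hq (if_neg h)
  obtain ⟨⟨h1, h2, h3⟩, ⟨⟨h4, h5, h6⟩, h7⟩, h8⟩ := hc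
  obtain ⟨n, rfl⟩ : ∃ n', n = n' + 1 := ⟨n - 1, by omega⟩
  simp only at κ m h4 h5 h6 h7 h8
  subst h5
  subst h6
  refine ⟨((m (Fin.last n), κ (Fin.last n)), ⟨n, fun i => (m i.castSucc, κ i.castSucc)⟩), ?_⟩
  have e1 : Fin.snoc (α := fun _ => ℕ) (fun i : Fin n => κ i.castSucc) (κ (Fin.last n)) = κ :=
    Fin.snoc_init_self κ
  have e2 : Fin.snoc (α := fun _ => ℕ) (fun i : Fin n => m i.castSucc) (m (Fin.last n)) = m :=
    Fin.snoc_init_self m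
  simp only [iS, e1, e2]
  rfl

def gS (x y z : ℂ) (a : ℕ × ℕ) : ℂ :=
  if 1 ≤ a.2 then 2 * x ^ (a.2 - 1 - (if 2 ≤ a.2 then 1 else 0))
    * y ^ (1 - (if 2 ≤ a.2 then 1 else 0)) * z ^ (2 * (if 2 ≤ a.2 then 1 else 0)) / (a.1 : ℂ) ^ a.2
  else 0

def hS (x t : ℂ) (a : ℕ × ℕ) : ℂ :=
  if 2 ≤ a.2 then 2 * x ^ (a.2 - 2) * t ^ a.1 / (a.1 : ℂ) ^ a.2 else 0

lemma prod_gS (x y z : ℂ) {n : ℕ} (c : Fin n → ℕ × ℕ) (hc : ∀ i, 1 ≤ (c i).2) :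
    ∏ i, gS x y z (c i) = 2 ^ n * x ^ ((∑ i, (c i).2) - n - (∑ i, if 2 ≤ (c i).2 then 1 else 0))
      * y ^ (n - (∑ i, if 2 ≤ (c i).2 then 1 else 0))
      * z ^ (2 * (∑ i, if 2 ≤ (c i).2 then 1 else 0)) / ∏ i, ((c i).1 : ℂ) ^ (c i).2 := by
  unfold gS
  rw [Finset.prod_congr rfl fun i _ => if_pos (hc i), Finset.prod_div_distrib,
    Finset.prod_mul_distrib, Finset.prod_mul_distrib, Finset.prod_mul_distrib,
    Finset.prod_pow_eq_pow_sum, Finset.prod_pow_eq_pow_sum, Finset.prod_pow_eq_pow_sum,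
    ← Finset.mul_sum]
  have e1 : (∑ i, (c i).2) = ∑ i, ((c i).2 - 1 - (if 2 ≤ (c i).2 then 1 else 0))
      + n + ∑ i, (if 2 ≤ (c i).2 then 1 else 0) := by
    have h0 : ∑ i : Fin n, 1 = n := by simp
    suffices h1 : (∑ i, (c i).2) = ∑ i, ((c i).2 - 1 - (if 2 ≤ (c i).2 then 1 else 0))
      + ∑ i : Fin n, 1 + ∑ i, (if 2 ≤ (c i).2 then 1 else 0) from
      h1.trans (by rw [h0])
    rw [← Finset.sum_add_distrib, ← Finset.sum_add_distrib]
    apply Finset.sum_congr rfl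
    intro i _
    have := hc i
    split_ifs <;> omega
  have e2 : n = ∑ i, (1 - (if 2 ≤ (c i).2 then 1 else 0))
      + ∑ i, (if 2 ≤ (c i).2 then 1 else 0) := by
    have h0 : ∑ i : Fin n, 1 = n := by simp
    refine h0.symm.trans ?_
    rw [← Finset.sum_add_distrib]
    apply Finset.sum_congr rfl
    intro i _
    split_ifs <;> omega
  congr 4
  · simp
  · congr 1; omega
  · omega

lemma HH_iS (x y z t : ℂ) (b) :
    HH x y z t (iS b) = hS x t b.1 * Vv (gS x y z) b.2.1 b.1.1 b.2.2 := by
  obtain ⟨⟨M, K⟩, ⟨n, c⟩⟩ := b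
  unfold HH iS mkS
  simp only [IdxCond0, IdxCond]
  rw [ath_snoc]
  simp only [Finset.card_filter, Fin.sum_univ_castSucc, Fin.prod_univ_castSucc, Fin.snoc_castSucc,
    Fin.snoc_last]
  have hl : lastExp (Fin.snoc (α := fun _ => ℕ) (fun i => (c i).1) M) = M := by
    unfold lastExp
    rw [dif_pos (Nat.succ_pos n)]
    exact Fin.snoc_last (α := fun _ => ℕ) M _
  have hl2 : ∀ h : n + 1 - 1 < n + 1, Fin.snoc (α := fun _ => ℕ) (fun i => (c i).2) K ⟨n + 1 - 1, h⟩ = K :=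
    fun h => Fin.snoc_last (α := fun _ => ℕ) K _
  rw [hl]
  simp only [hl2]
  unfold Vv hS
  simp only
  by_cases hK : 2 ≤ K
  swap
  · rw [if_neg, if_neg hK, zero_mul]
    rintro ⟨_, ⟨_, h⟩, _⟩
    exact hK (h (Nat.succ_pos n))
  by_cases hC : cnd n M (fun i => (c i).1)
  swap
  · rw [if_neg hC, if_neg, mul_zero]
    rintro ⟨_, _, h⟩
    exact hC h
  by_cases hc : ∀ i, 1 ≤ (c i).2
  swap
  · rw [if_neg, if_pos hC]
    · push Not at hc
      obtain ⟨i, hi⟩ := hc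
      rw [Finset.prod_eq_zero (Finset.mem_univ i), mul_zero]
      rw [gS, if_neg (by omega)]
    · rintro ⟨_, ⟨⟨h, _⟩, _⟩, _⟩
      apply hc
      intro i
      simpa using h i.castSucc
  rw [if_pos, if_pos hK, if_pos hC, prod_gS x y z c hc, if_pos hK]
  · set S := ∑ i, (c i).2 with hS
    set s := ∑ i, (if 2 ≤ (c i).2 then 1 else 0) with hs
    have hsn : s ≤ n := by
      calc s ≤ ∑ i : Fin n, 1 := Finset.sum_le_sum fun i _ => by split_ifs <;> omega
        _ = n := by simp
    have hSn : n + s ≤ S := by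
      calc n + s = ∑ i : Fin n, (1 + if 2 ≤ (c i).2 then 1 else 0) := by
            rw [Finset.sum_add_distrib]; simp [hs]
        _ ≤ S := Finset.sum_le_sum fun i _ => by have := hc i; split_ifs <;> omega
    have e1 : S + K - (n + 1) - (s + 1) = (S - n - s) + (K - 2) := by omega
    have e2 : n + 1 - (s + 1) = n - s := by omega
    have e3 : 2 * (s + 1 - 1) = 2 * s := by omega
    rw [e1, e2, e3, pow_succ, pow_add]
    rw [div_eq_mul_inv, div_eq_mul_inv, div_eq_mul_inv, mul_inv]
    ring
  · refine ⟨⟨by omega, by omega, by rw [if_pos hK]; omega⟩, ⟨⟨?_, trivial, trivial⟩, fun _ => hK⟩, hC⟩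
    intro i
    induction i using Fin.lastCases with
    | last => simp; omega
    | cast i => simpa using hc i

lemma hasSum_geo2 {𝕜 : Type*} [NormedField 𝕜] {f : ℕ → 𝕜} {A B r : 𝕜} (hr : ‖r‖ < 1)
    (h0 : f 0 = 0) (h1 : f 1 = A) (h2 : ∀ k, f (k + 2) = B * r ^ k) :
    HasSum f (A + B * (1 - r)⁻¹) := by
  rw [← hasSum_nat_add_iff' 2]
  simp only [h2, Finset.sum_range_succ, Finset.sum_range_zero, h0, h1]
  have e : A + B * (1 - r)⁻¹ - (0 + 0 + A) = B * (1 - r)⁻¹ := by ring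
  rw [e]
  exact (hasSum_geometric_of_norm_lt_one hr).mul_left B

lemma enorm_tsum {f : ℕ → ℂ} {S : ℝ} (h : HasSum (fun k => ‖f k‖) S) :
    ∑' k, ‖f k‖ₑ = ENNReal.ofReal S := by
  rw [← h.tsum_eq, ENNReal.ofReal_tsum_of_nonneg (fun _ => norm_nonneg _) h.summable]
  simp

lemma Pseq_congr {R : Type*} [CommSemiring R] {w v : ℕ → R} (h : ∀ m, 1 ≤ m → w m = v m) :
    ∀ M, Pseq w M = Pseq v M
  | 0 => by simp [Pseq]
  | 1 => by simp [Pseq]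
  | (n + 2) => by
    rw [Pseq, Pseq, Pseq_congr h n, Pseq_congr h (n + 1), h (n + 1) (by omega)]

lemma Pseq_bound_enn {w : ℕ → ENNReal} (hw : ∀ m : ℕ, 1 ≤ m → w m ≤ (m : ENNReal)⁻¹) :
    ∀ M : ℕ, Pseq w M ≤ M
  | 0 => by simp [Pseq]
  | 1 => by simp [Pseq]
  | (n + 2) => by
    have h1 := Pseq_bound_enn hw n
    have h2 := Pseq_bound_enn hw (n + 1)
    rw [Pseq]
    calc Pseq w n + w (n + 1) * Pseq w (n + 1)
        ≤ n + ((n + 1 : ℕ) : ENNReal)⁻¹ * ((n + 1 : ℕ) : ENNReal) :=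
          add_le_add h1 (mul_le_mul' (hw _ (by omega)) h2)
      _ ≤ n + 1 := by gcongr; exact ENNReal.inv_mul_le_one _
      _ ≤ ((n + 2 : ℕ) : ENNReal) := by push_cast; gcongr; norm_num

lemma xm_lt {x : ℂ} (hx : ‖x‖ < 1 / 2) {m : ℕ} (hm : 1 ≤ m) : ‖x‖ / m < 1 / 2 := by
  have : (1 : ℝ) ≤ m := by exact_mod_cast hm
  exact (div_le_self (norm_nonneg x) this).trans_lt hx

lemma gS_sum {x y z : ℂ} (hx : ‖x‖ < 1 / 2) (hxr : x.re < 0) (hz : z ^ 2 = x * y / 2) {m : ℕ}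
    (hm : 1 ≤ m) : ∑' k, gS x y z (m, k) = wC x y m := by
  have hm0 : (m : ℂ) ≠ 0 := by exact_mod_cast (by omega : m ≠ 0)
  have hr : ‖x / (m : ℂ)‖ < 1 := by
    rw [norm_div, Complex.norm_natCast]
    linarith [xm_lt hx hm]
  have := hasSum_geo2 (f := fun k => gS x y z (m, k)) (A := 2 * y / m) (B := 2 * z ^ 2 / m ^ 2) hr
    (by simp [gS]) (by simp [gS]) (by
      intro k
      simp only [gS]
      rw [if_pos (by omega), if_pos (by omega)]
      have : k + 2 - 1 - 1 = k := by omega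
      rw [this]
      simp only [Nat.sub_self, pow_zero, mul_one, div_pow]
      field_simp
      ring)
  rw [this.tsum_eq, hz, wC]
  have h1 := natsub_ne hxr m
  have h2 : 1 - x / (m : ℂ) ≠ 0 := by
    intro h
    apply h1
    field_simp at h
    simpa using h
  have h3 : (1 - x / (m : ℂ))⁻¹ = m / (m - x) := by
    field_simp
  rw [h3]
  field_simp
  ring

lemma hS_sum {x t : ℂ} (hx : ‖x‖ < 1 / 2) (hxr : x.re < 0) {m : ℕ}
    (hm : 1 ≤ m) : ∑' k, hS x t (m, k) = 2 / (m * (m - x)) * t ^ m := by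
  have hm0 : (m : ℂ) ≠ 0 := by exact_mod_cast (by omega : m ≠ 0)
  have hr : ‖x / (m : ℂ)‖ < 1 := by
    rw [norm_div, Complex.norm_natCast]
    linarith [xm_lt hx hm]
  have := hasSum_geo2 (f := fun k => hS x t (m, k)) (A := 0) (B := 2 * t ^ m / m ^ 2) hr
    (by simp [hS]) (by simp [hS]) (by
      intro k
      simp only [hS]
      rw [if_pos (by omega)]
      have : k + 2 - 2 = k := by omega
      rw [this]
      simp only [div_pow]
      field_simp
      ring)
  rw [this.tsum_eq]
  have h1 := natsub_ne hxr m
  have h3 : (1 - x / (m : ℂ))⁻¹ = m / (m - x) := by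
    have : 1 - x / (m : ℂ) = (m - x) / m := by field_simp
    rw [this, inv_div]
  rw [h3]
  field_simp
  ring

lemma gS_esum {x y z : ℂ} (hx : ‖x‖ < 1 / 2) (hy : ‖y‖ < 1 / 4) (hz : z ^ 2 = x * y / 2) {m : ℕ}
    (hm : 1 ≤ m) : ∑' k, ‖gS x y z (m, k)‖ₑ ≤ (m : ENNReal)⁻¹ := by
  have hm1 : (1 : ℝ) ≤ m := by exact_mod_cast hm
  have hxm := xm_lt hx hm
  have hr : ‖‖x‖ / (m : ℝ)‖ < 1 := by
    rw [Real.norm_of_nonneg (by positivity)]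
    linarith
  have hzn : ‖z‖ ^ 2 = ‖x‖ * ‖y‖ / 2 := by
    rw [← norm_pow, hz]; simp
  have := hasSum_geo2 (f := fun k => ‖gS x y z (m, k)‖) (A := 2 * ‖y‖ / m)
    (B := 2 * ‖z‖ ^ 2 / m ^ 2) hr
    (by simp [gS]) (by simp [gS]) (by
      intro k
      simp only [gS]
      rw [if_pos (by omega), if_pos (by omega)]
      have : k + 2 - 1 - 1 = k := by omega
      rw [this]
      simp only [Nat.sub_self, pow_zero, mul_one, div_pow, norm_mul, norm_div, norm_pow,
        Complex.norm_natCast, Complex.norm_ofNat]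
      field_simp
      ring)
  rw [enorm_tsum this, hzn]
  have h5 : (m : ENNReal)⁻¹ = ENNReal.ofReal (1 / m) := by
    rw [one_div, ENNReal.ofReal_inv_of_pos (by linarith), ENNReal.ofReal_natCast]
  rw [h5]
  apply ENNReal.ofReal_le_ofReal
  have h6 : (1 - ‖x‖ / (m : ℝ))⁻¹ ≤ 2 := by
    rw [inv_le_comm₀ (by linarith) (by norm_num)]
    linarith
  have h7 : 2 * (‖x‖ * ‖y‖ / 2) / (m : ℝ) ^ 2 ≤ (1 / 8) / m := by
    have : 2 * (‖x‖ * ‖y‖ / 2) / (m : ℝ) ^ 2 = (‖x‖ / m * ‖y‖) / m := by field_simp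
    rw [this]
    gcongr
    calc ‖x‖ / m * ‖y‖ ≤ 1 / 2 * (1 / 4) := by gcongr
      _ = 1 / 8 := by norm_num
  calc 2 * ‖y‖ / m + 2 * (‖x‖ * ‖y‖ / 2) / (m : ℝ) ^ 2 * (1 - ‖x‖ / (m : ℝ))⁻¹
      ≤ 2 * (1 / 4) / m + (1 / 8) / m * 2 := by
        gcongr
        exact inv_nonneg.2 (by linarith)
    _ ≤ 1 / m := by
        have : 2 * (1 / 4) / (m : ℝ) + (1 / 8) / m * 2 = (3 / 4) / m := by ring
        rw [this]
        gcongr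
        norm_num

lemma hS_esum {x : ℂ} {t : ℝ} (ht : 0 ≤ t) (hx : ‖x‖ < 1 / 2) {m : ℕ}
    (hm : 1 ≤ m) : ∑' k, ‖hS x t (m, k)‖ₑ ≤ ENNReal.ofReal (4 * t ^ m) := by
  have hm1 : (1 : ℝ) ≤ m := by exact_mod_cast hm
  have hxm := xm_lt hx hm
  have hr : ‖‖x‖ / (m : ℝ)‖ < 1 := by
    rw [Real.norm_of_nonneg (by positivity)]
    linarith
  have := hasSum_geo2 (f := fun k => ‖hS x t (m, k)‖) (A := 0)
    (B := 2 * t ^ m / m ^ 2) hr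
    (by simp [hS]) (by simp [hS]) (by
      intro k
      simp only [hS]
      rw [if_pos (by omega)]
      have : k + 2 - 2 = k := by omega
      rw [this]
      simp only [div_pow, norm_mul, norm_div, norm_pow, Complex.norm_real, Real.norm_of_nonneg ht,
        Complex.norm_natCast, Complex.norm_ofNat]
      field_simp
      ring)
  rw [enorm_tsum this]
  apply ENNReal.ofReal_le_ofReal
  have h6 : (1 - ‖x‖ / (m : ℝ))⁻¹ ≤ 2 := by
    rw [inv_le_comm₀ (by linarith) (by norm_num)]
    linarith
  have h7 : 2 * t ^ m / (m : ℝ) ^ 2 ≤ 2 * t ^ m := div_le_self (by positivity) (one_le_pow₀ hm1)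
  calc 0 + 2 * t ^ m / (m : ℝ) ^ 2 * (1 - ‖x‖ / (m : ℝ))⁻¹
      ≤ 0 + 2 * t ^ m * 2 := by
        gcongr
        exact inv_nonneg.2 (by linarith)
    _ = 4 * t ^ m := by ring

lemma hfin_aux {x y z : ℂ} (hx : ‖x‖ < 1 / 2) {t : ℝ} (ht : 0 ≤ t) (ht1 : t < 1)
    (hP : ∀ m : ℕ, Pseq (fun m => ∑' k, ‖gS x y z (m, k)‖ₑ) m ≤ m) :
    ∑' m, (∑' k, ‖hS x t (m, k)‖ₑ) * Pseq (fun m => ∑' k, ‖gS x y z (m, k)‖ₑ) m ≠ ⊤ := by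
  have h0 : Summable (fun m : ℕ => (m : ℝ) ^ 1 * t ^ m) :=
    summable_pow_mul_geometric_of_norm_lt_one 1 (by rw [Real.norm_of_nonneg ht]; exact ht1)
  have hsum : Summable (fun m : ℕ => 4 * ((m : ℝ) ^ 1 * t ^ m)) := h0.mul_left 4
  refine ne_top_of_le_ne_top hsum.tsum_ofReal_ne_top (ENNReal.tsum_le_tsum fun m => ?_)
  rcases Nat.eq_zero_or_pos m with h | hm
  · rw [h, Pseq, mul_zero]
    exact zero_le
  · refine (mul_le_mul' (hS_esum ht hx hm) (hP m)).trans (le_of_eq ?_)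
    rw [← ENNReal.ofReal_natCast, ← ENNReal.ofReal_mul (by positivity)]
    congr 1; ring

lemma Phi0_ser {x y z : ℂ} (hx : ‖x‖ < 1 / 2) (hxr : x.re < 0) (hy : ‖y‖ < 1 / 4)
    (hz : z ^ 2 = x * y / 2) {t : ℝ} (ht : 0 ≤ t) (ht1 : t < 1) :
    Phi0 x y z t = ∑' M : ℕ, Pseq (wC x y) M * (2 / (M * (M - x))) * (t : ℂ) ^ M := by
  have hP := Pseq_bound_enn (w := fun m => ∑' k, ‖gS x y z (m, k)‖ₑ)
    (fun m hm => gS_esum hx hy hz hm)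
  have hT := total_sum (gS x y z) (hS x t) (hfin_aux hx ht ht1 hP)
    (fun m => ne_top_of_le_ne_top (ENNReal.natCast_ne_top m) (hP m))
  have hcomp : HH x y z t ∘ iS = fun b => hS x t b.1 * Vv (gS x y z) b.2.1 b.1.1 b.2.2 :=
    funext fun b => HH_iS x y z t b
  have hsm : Summable (HH x y z t) := by
    rw [← iS_inj.summable_iff (f := HH x y z t), hcomp]
    · exact hT.1
    · intro q hq
      by_contra h
      exact hq (HH_support x y z t h)
  rw [Phi0_eq_s15 x y z t hsm, ← iS_inj.tsum_eq (HH_support x y z t)]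
  simp_rw [HH_iS]
  rw [hT.2]
  congr 1
  ext m
  rcases Nat.eq_zero_or_pos m with rfl | hm
  · simp [Pseq]
  · rw [hS_sum hx hxr hm, Pseq_congr (fun m hm => gS_sum hx hxr hz hm) m]
    ring

/-- The limit of `u(t) = 1 − (xy/2)Φ₀(x,y,z;t)` as `t → 1⁻` is
`(Γ(1−x)Γ(1−y)/Γ(1−x−y)) · (Γ(1−(x+y)/2)/(Γ(1−x/2)Γ(1−y/2)))`. -/
theorem u_limit_at_one (x y z : ℂ) (hrex : x.re < 0)
    (hrey0 : 0 < y.re) (hrey1 : y.re < 1)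
    (hx : ‖x‖ < 1 / 2) (hy : ‖y‖ < 1 / 4) (hx0 : x ≠ 0) (hy0 : y ≠ 0)
    (hz : z ^ 2 = x * y / 2) :
    Filter.Tendsto (fun t : ℝ => 1 - x * y / 2 * Phi0 x y z t)
      (nhdsWithin 1 (Set.Iio 1))
      (nhds (Complex.Gamma (1 - x) * Complex.Gamma (1 - y) / Complex.Gamma (1 - x - y)
        * (Complex.Gamma (1 - (x + y) / 2)
            / (Complex.Gamma (1 - x / 2) * Complex.Gamma (1 - y / 2))))) := by
  have hyr : |y.re| < 1 / 4 := (Complex.abs_re_le_norm y).trans_lt hy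
  have hxa : |x.re| < 1 / 2 := (Complex.abs_re_le_norm x).trans_lt hx
  have hy2 := abs_lt.1 hyr
  have hx2 := abs_lt.1 hxa
  have re2 : ∀ c : ℂ, (c / 2).re = c.re / 2 := fun c => by simp
  have hb : 0 < ((1 + y - x) / 2).re := by
    rw [re2]; simp; linarith
  have hd : 0 < ((1 - x - y) / 2).re := by
    rw [re2]; simp; linarith
  have he : 0 < ((1 - y) / 2).re := by
    rw [re2]; simp; linarith
  rw [← gamma_final hb hd he hrex hrey1]
  refine ((Ju_lim hrex hb hd he).div_const _).congr' ?_
  filter_upwards [Ioo_mem_nhdsLT (show (0 : ℝ) < 1 by norm_num)] with t ht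
  rw [Phi0_ser hx hrex hy hz ht.1.le ht.2]
  exact (u_eq hrex hy hb hd ht.1.le ht.2).symm

end
end
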